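/- arXiv:1501.05021 — 3 statements merged into one kernel-verified Lean document; each statement's English description precedes it below -/
import Mathlib

section
/- For any constant c < 1 there exist constants C₂ and C₃ such that the following holds for the two-block stochastic block model SBM(n,a,b) with d := a+b. Let Ā₀ = E[A₀] be the expected adjacency matrix, let A be obtained from the adjacency matrix A₀ by zeroing out rows and columns of vertices of degree greater than 20d, let W̄ be the span of the eigenvectors of Ā₀ corresponding to its two largest eigenvalues, and let W be the span of the eigenvectors of A corresponding to its two largest eigenvalues. If a − b ≥ C₂·√d and a ≥ C₃, then with probability 1 − o(1), sin∠(W̄, W) ≤ c. -/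
open MeasureTheory Filter Finset

/-- The Bernoulli measure on `Bool` with success probability `p` (clamped to `[0,1]`). -/
noncomputable def bern (p : ℝ) : Measure Bool :=
  (PMF.bernoulli (min (Real.toNNReal p) 1) (min_le_right _ _)).toMeasure

instance (p : ℝ) : IsProbabilityMeasure (bern p) := by
  unfold bern; infer_instance

/-- Index set for the unordered pairs of distinct vertices of `Fin N`. -/
abbrev EdgeIdx (N : ℕ) := {e : Fin N × Fin N // e.1 < e.2}

/-- A configuration of edges: which unordered pairs form an edge. -/
abbrev Config (N : ℕ) := EdgeIdx N → Bool

/-- A colored configuration: for every pair, (edge present, edge Red). For the censor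
block model the second component is instead the noise bit of the pair. -/
abbrev CConfig (N : ℕ) := EdgeIdx N → Bool × Bool

/-- Adjacency relation of the graph determined by a configuration. -/
def adjOf {N : ℕ} (ω : Config N) (i j : Fin N) : Bool :=
  if h : i < j then ω ⟨(i, j), h⟩ else if h : j < i then ω ⟨(j, i), h⟩ else false

/-- Degree of a vertex in the graph determined by a configuration. -/
def degOf {N : ℕ} (ω : Config N) (v : Fin N) : ℕ :=
  (univ.filter fun j => adjOf ω v j).card

/-- The two-block stochastic block model `SBM(n,a,b)` on `2*n` vertices: within-block
pairs are edges with probability `a/n`, cross-block pairs with probability `b/n`,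
independently. -/
noncomputable def sbm2 (n : ℕ) (a b : ℝ) : Measure (Config (2 * n)) :=
  Measure.pi fun e =>
    bern (if ((e.1.1 : ℕ) < n ↔ (e.1.2 : ℕ) < n) then a / n else b / n)

/-- The first block `V₁` (the first `n` vertices). -/
def block1 (n : ℕ) : Finset (Fin (2 * n)) := univ.filter fun i => (i : ℕ) < n

/-- The second block `V₂` (the last `n` vertices). -/
def block2 (n : ℕ) : Finset (Fin (2 * n)) := univ.filter fun i => ¬ (i : ℕ) < n

/-- `(V₁', V₂')` is `γ`-correct: `|Vᵢ ∩ Vᵢ'| ≥ (1-γ)n` for `i = 1,2`. -/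
def correct2 (n : ℕ) (γ : ℝ) (P : Finset (Fin (2 * n)) × Finset (Fin (2 * n))) : Prop :=
  (1 - γ) * (n : ℝ) ≤ ((block1 n ∩ P.1).card : ℝ) ∧
  (1 - γ) * (n : ℝ) ≤ ((block2 n ∩ P.2).card : ℝ)

/-- A pair of disjoint subsets partitioning the vertex set. -/
def isPartition2 {N : ℕ} (P : Finset (Fin N) × Finset (Fin N)) : Prop :=
  Disjoint P.1 P.2 ∧ P.1 ∪ P.2 = univ

/-- Expected adjacency matrix of `SBM(n,a,b)`. -/
noncomputable def expAdj (n : ℕ) (a b : ℝ) : Matrix (Fin (2 * n)) (Fin (2 * n)) ℝ :=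
  fun i j => if i = j then 0 else if ((i : ℕ) < n ↔ (j : ℕ) < n) then a / n else b / n

/-- Adjacency matrix (over `ℝ`) of the graph determined by a configuration. -/
noncomputable def adjMat {N : ℕ} (ω : Config N) : Matrix (Fin N) (Fin N) ℝ :=
  fun i j => if adjOf ω i j then 1 else 0

/-- Zero out all rows and columns corresponding to vertices of degree `> 20 d`. -/
noncomputable def zeroOutHighDeg {N : ℕ} (d : ℝ) (ω : Config N)
    (M : Matrix (Fin N) (Fin N) ℝ) : Matrix (Fin N) (Fin N) ℝ :=
  fun i j => if 20 * d < (degOf ω i : ℝ) ∨ 20 * d < (degOf ω j : ℝ) then 0 else M i j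

/-- The spectral (ℓ² operator) norm of a real square matrix. -/
noncomputable def opNorm {N : ℕ} (M : Matrix (Fin N) (Fin N) ℝ) : ℝ :=
  ‖LinearMap.toContinuousLinearMap (Matrix.toEuclideanLin M)‖

/-- The orthogonal projection onto a subspace, as an endomorphism. -/
noncomputable def projCLM {N : ℕ} (W : Submodule ℝ (EuclideanSpace ℝ (Fin N))) :
    EuclideanSpace ℝ (Fin N) →L[ℝ] EuclideanSpace ℝ (Fin N) :=
  W.subtypeL.comp (Submodule.orthogonalProjectionOnto W)

/-- `sin ∠(W₁, W₂) := ‖P_{W₁} - P_{W₂}‖`. -/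
noncomputable def sinAngle {N : ℕ} (W₁ W₂ : Submodule ℝ (EuclideanSpace ℝ (Fin N))) : ℝ :=
  ‖projCLM W₁ - projCLM W₂‖

/-- Build a vector of `EuclideanSpace ℝ (Fin N)` from its coordinates. -/
noncomputable def mkVec {N : ℕ} (f : Fin N → ℝ) : EuclideanSpace ℝ (Fin N) :=
  (EuclideanSpace.equiv (Fin N) ℝ).symm f

/-- `W` is the eigenspace corresponding to the top two eigenvalues of the symmetric
matrix `M`: it is spanned by two orthonormal eigenvectors whose eigenvalues dominate
every eigenvalue attained on `Wᗮ`. -/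
def IsTopTwoSpace {N : ℕ} (M : Matrix (Fin N) (Fin N) ℝ)
    (W : Submodule ℝ (EuclideanSpace ℝ (Fin N))) : Prop :=
  ∃ (u₁ u₂ : EuclideanSpace ℝ (Fin N)) (μ₁ μ₂ : ℝ),
    (inner ℝ u₁ u₂ : ℝ) = 0 ∧ ‖u₁‖ = 1 ∧ ‖u₂‖ = 1 ∧
    W = Submodule.span ℝ {u₁, u₂} ∧
    Matrix.toEuclideanLin M u₁ = μ₁ • u₁ ∧
    Matrix.toEuclideanLin M u₂ = μ₂ • u₂ ∧
    ∀ (μ : ℝ) (v : EuclideanSpace ℝ (Fin N)), v ≠ 0 → v ∈ Wᗮ →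
      Matrix.toEuclideanLin M v = μ • v → μ ≤ min μ₁ μ₂

/-- `P` is a possible output of the **Spectral Partition** algorithm run on the
configuration `ω` with degree parameter `d`. -/
def IsSpectralOutput (n : ℕ) (ω : Config (2 * n)) (d : ℝ)
    (P : Finset (Fin (2 * n)) × Finset (Fin (2 * n))) : Prop :=
  ∃ (W : Submodule ℝ (EuclideanSpace ℝ (Fin (2 * n))))
    (v : EuclideanSpace ℝ (Fin (2 * n))),
    IsTopTwoSpace (zeroOutHighDeg d ω (adjMat ω)) W ∧
    v ∈ W ∧ ‖v‖ = 1 ∧ (inner ℝ (projCLM W (mkVec fun _ => 1)) v : ℝ) = 0 ∧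
    P.1.card = n ∧ P.2 = P.1ᶜ ∧ ∀ i ∈ P.1, ∀ j ∈ P.2, v j ≤ v i

/-- The two-block SBM together with an independent fair Red/Blue coloring of each edge:
first component = edge present, second component = edge colored Red. -/
noncomputable def sbm2c (n : ℕ) (a b : ℝ) : Measure (CConfig (2 * n)) :=
  Measure.pi fun e =>
    (bern (if ((e.1.1 : ℕ) < n ↔ (e.1.2 : ℕ) < n) then a / n else b / n)).prod
      (bern (1 / 2))

/-- The Red subgraph of a colored configuration. -/
def redConf {N : ℕ} (ω : CConfig N) : Config N := fun e => (ω e).1 && (ω e).2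

/-- The Blue subgraph of a colored configuration. -/
def blueConf {N : ℕ} (ω : CConfig N) : Config N := fun e => (ω e).1 && !(ω e).2

/-- Number of Blue neighbors of `u` inside `S`. -/
noncomputable def blueDegIn {N : ℕ} (ω : CConfig N) (S : Finset (Fin N)) (u : Fin N) : ℕ :=
  (S.filter fun v => adjOf (blueConf ω) u v).card

/-- Number of Red neighbors of `u` inside `S`. -/
noncomputable def redDegIn {N : ℕ} (ω : CConfig N) (S : Finset (Fin N)) (u : Fin N) : ℕ :=
  (S.filter fun v => adjOf (redConf ω) u v).card

/-- The **Correction** subroutine with threshold `t`: a vertex of `P.i` is bad if it has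
at least `t` Blue neighbors in the other class; bad vertices are moved to the other side. -/
noncomputable def corrected2 {N : ℕ} (t : ℝ) (ω : CConfig N)
    (P : Finset (Fin N) × Finset (Fin N)) : Finset (Fin N) × Finset (Fin N) :=
  let bad1 := P.1.filter fun u => t ≤ (blueDegIn ω P.2 u : ℝ)
  let bad2 := P.2.filter fun u => t ≤ (blueDegIn ω P.1 u : ℝ)
  ((P.1 \ bad1) ∪ bad2, (P.2 \ bad2) ∪ bad1)

/-- The `k`-block SBM on `k*m` vertices (`k` blocks of size `m`, so `n = k*m` total
vertices and edge probabilities `a/n` within blocks and `b/n` across). -/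
noncomputable def sbmK (k m : ℕ) (a b : ℝ) : Measure (Config (k * m)) :=
  Measure.pi fun e =>
    bern (if (e.1.1 : ℕ) / m = (e.1.2 : ℕ) / m then a / (k * m) else b / (k * m))

/-- The `i`-th block `Vᵢ` (of size `m = n/k`). -/
def blockK (k m : ℕ) (i : Fin k) : Finset (Fin (k * m)) :=
  univ.filter fun v => (v : ℕ) / m = (i : ℕ)

/-- The subset `Z` selected by the splitting coins `s` (its complement is `Y`). -/
def Zset {N : ℕ} (s : Fin N → Bool) : Finset (Fin N) := univ.filter fun v => s v = true

/-- The `k`-block SBM together with a uniformly random split of the vertices. -/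
noncomputable def sbmKs (k m : ℕ) (a b : ℝ) :
    Measure ((Fin (k * m) → Bool) × Config (k * m)) :=
  (Measure.pi fun _ : Fin (k * m) => bern (1 / 2)).prod (sbmK k m a b)

/-- The `k`-block SBM together with a uniformly random split of the vertices and an
independent fair Red/Blue coloring of each edge. -/
noncomputable def sbmKsc (k m : ℕ) (a b : ℝ) :
    Measure ((Fin (k * m) → Bool) × CConfig (k * m)) :=
  (Measure.pi fun _ : Fin (k * m) => bern (1 / 2)).prod
    (Measure.pi fun e : EdgeIdx (k * m) =>
      (bern (if (e.1.1 : ℕ) / m = (e.1.2 : ℕ) / m then a / (k * m) else b / (k * m))).prod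
        (bern (1 / 2)))

/-- `U` is a `γ`-correct partition of `Z = (V₁ ∩ Z) ∪ ... ∪ (V_k ∩ Z)`:
a collection of disjoint subsets of `Z` covering `Z` with
`|(Vᵢ ∩ Z) ∩ Uᵢ| ≥ (1-γ)|Vᵢ ∩ Z|` for every `i`. -/
def correctOnZ (k m : ℕ) (γ : ℝ) (s : Fin (k * m) → Bool)
    (U : Fin k → Finset (Fin (k * m))) : Prop :=
  (∀ i, U i ⊆ Zset s) ∧ (∀ i j, i ≠ j → Disjoint (U i) (U j)) ∧
  (univ.biUnion U = Zset s) ∧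
  ∀ i, (1 - γ) * ((blockK k m i ∩ Zset s).card : ℝ) ≤
    (((blockK k m i ∩ Zset s) ∩ U i).card : ℝ)

/-- Censor block model: for every pair of vertices, an independent pair
(edge present with probability `p`, noise bit with probability `ε`). -/
noncomputable def cbmMeasure (n : ℕ) (p ε : ℝ) : Measure (CConfig (2 * n)) :=
  Measure.pi fun _ => (bern p).prod (bern ε)

/-- The observation `y = B_G x ⊕ z` of the censor block model: for each present edge
`(i,j)` one observes `x_i ⊕ x_j ⊕ z_e` (where `x` is the indicator of the second
block); nothing is observed on absent edges. -/
def cbmObs (n : ℕ) (ω : CConfig (2 * n)) (e : EdgeIdx (2 * n)) : Option Bool :=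
  if (ω e).1 then
    some (xor (xor (decide ((e.1.1 : ℕ) < n)) (decide ((e.1.2 : ℕ) < n))) (ω e).2)
  else none

/-- `e(S,T)`: adjacency-matrix count of edges between `S` and `T` in a simple graph. -/
def eCount {n : ℕ} (G : SimpleGraph (Fin n)) [DecidableRel G.Adj]
    (S T : Finset (Fin n)) : ℝ :=
  ∑ i ∈ S, ∑ j ∈ T, if G.Adj i j then 1 else 0

/-- `e(S,T)` for the graph of a configuration. -/
def eCountC {n : ℕ} (ω : Config n) (S T : Finset (Fin n)) : ℝ :=
  ∑ i ∈ S, ∑ j ∈ T, if adjOf ω i j then 1 else 0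

/-- The random symmetric matrix model: independent edges, pair `(i,j)` present with
probability `p i j`. -/
noncomputable def genMeasure {n : ℕ} (p : Fin n → Fin n → ℝ) : Measure (Config n) :=
  Measure.pi fun e => bern (p e.1.1 e.1.2)

/-- The centered matrix `M` with `M_ij = 1 - p_ij` if the pair is present and
`M_ij = -p_ij` otherwise, and zero diagonal. -/
noncomputable def centeredMat {n : ℕ} (p : Fin n → Fin n → ℝ) (ω : Config n) :
    Matrix (Fin n) (Fin n) ℝ :=
  fun i j => if i = j then 0 else (if adjOf ω i j then 1 else 0) - p i j

/-- Number of positive entries in row `i` of `M`. -/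
noncomputable def posRowCount {n : ℕ} (M : Matrix (Fin n) (Fin n) ℝ) (i : Fin n) : ℕ :=
  (univ.filter fun j => 0 < M i j).card

/-- Zero out the rows and columns indexed by `S`. -/
noncomputable def zeroOutRows {n : ℕ} (S : Finset (Fin n)) (M : Matrix (Fin n) (Fin n) ℝ) :
    Matrix (Fin n) (Fin n) ℝ :=
  fun i j => if i ∈ S ∨ j ∈ S then 0 else M i j

/-- The all-ones direction `v̄₁` (unit vector). -/
noncomputable def vbar1 (n : ℕ) : EuclideanSpace ℝ (Fin (2 * n)) :=
  mkVec fun _ => 1 / Real.sqrt (2 * n)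

/-- The block-indicator direction `v̄₂` (unit vector). -/
noncomputable def vbar2 (n : ℕ) : EuclideanSpace ℝ (Fin (2 * n)) :=
  mkVec fun i =>
    if (i : ℕ) < n then 1 / Real.sqrt (2 * n) else -(1 / Real.sqrt (2 * n))

section Perturbation

variable {E : Type*} [NormedAddCommGroup E] [InnerProductSpace ℝ E] [FiniteDimensional ℝ E]

/-- If every eigenvalue of a symmetric operator is at most `m`, so is its quadratic form. -/
lemma LinearMap.IsSymmetric.inner_le_of_eigenvalue_le {T : E →ₗ[ℝ] E} (hT : T.IsSymmetric)
    {m : ℝ} (h : ∀ (μ : ℝ) (v : E), v ≠ 0 → T v = μ • v → μ ≤ m) (x : E) :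
    inner ℝ (T x) x ≤ m * ‖x‖ ^ 2 := by
  set b := hT.eigenvectorBasis rfl
  have hb : ∀ i, T (b i) = hT.eigenvalues rfl i • b i := fun i =>
    hT.apply_eigenvectorBasis rfl i
  rw [← b.sum_inner_mul_inner (T x) x, ← real_inner_self_eq_norm_sq x,
    ← b.sum_inner_mul_inner x x, Finset.mul_sum]
  refine Finset.sum_le_sum fun i _ => ?_
  rw [hT x (b i), hb i, inner_smul_right, real_inner_comm x (b i)]
  have h1 := h _ (b i) (b.orthonormal.ne_zero i) (hb i)
  nlinarith [mul_self_nonneg (inner ℝ x (b i))]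

/-- The quadratic form of a symmetric operator is bounded by `m` on the orthogonal complement of
an invariant subspace as soon as all eigenvalues attained there are at most `m`. -/
lemma LinearMap.IsSymmetric.inner_le_on_orthogonal {T : E →ₗ[ℝ] E} (hT : T.IsSymmetric)
    {W : Submodule ℝ E} (hW : ∀ w ∈ W, T w ∈ W) {m : ℝ}
    (h : ∀ (μ : ℝ) (v : E), v ≠ 0 → v ∈ Wᗮ → T v = μ • v → μ ≤ m) {x : E} (hx : x ∈ Wᗮ) :
    inner ℝ (T x) x ≤ m * ‖x‖ ^ 2 := by
  have hinv : ∀ v ∈ Wᗮ, T v ∈ Wᗮ := fun v hv w hw => by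
    rw [← hT w v]; exact hv _ (hW w hw)
  refine (hT.restrict_invariant hinv).inner_le_of_eigenvalue_le (m := m) ?_ ⟨x, hx⟩
  intro μ v hv hTv
  refine h μ v (by simpa using hv) v.2 ?_
  simpa using congrArg Subtype.val hTv

lemma exists_ne_zero_mem_inner_eq_zero {U : Submodule ℝ E} (hU : Module.finrank ℝ U = 2) (u : E) :
    ∃ v ∈ U, v ≠ 0 ∧ inner ℝ u v = (0 : ℝ) := by
  let φ : U →ₗ[ℝ] ℝ := (innerₛₗ ℝ u).comp U.subtype
  have hφ : φ.ker ≠ ⊥ := by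
    apply LinearMap.ker_ne_bot_of_finrank_lt
    rw [hU]; simp
  obtain ⟨v, hv, hv0⟩ := Submodule.exists_mem_ne_zero_of_ne_bot hφ
  exact ⟨v, v.2, by simpa using hv0, by simpa [φ] using hv⟩

/-- Weyl-type lower bound for the smaller of the two top eigenvalues. -/
lemma le_of_top_two {T : E →ₗ[ℝ] E} (hT : T.IsSymmetric) {U : Submodule ℝ E}
    (hU : Module.finrank ℝ U = 2) {g : ℝ} (hg : ∀ x ∈ U, g * ‖x‖ ^ 2 ≤ inner ℝ (T x) x)
    {u₁ u₂ : E} {μ₁ μ₂ : ℝ} (h12 : inner ℝ u₁ u₂ = (0 : ℝ)) (h2 : ‖u₂‖ = 1)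
    (e1 : T u₁ = μ₁ • u₁) (e2 : T u₂ = μ₂ • u₂)
    (h : ∀ (μ : ℝ) (v : E), v ≠ 0 → v ∈ (Submodule.span ℝ {u₁, u₂})ᗮ → T v = μ • v → μ ≤ μ₂) :
    g ≤ μ₂ := by
  set W := Submodule.span ℝ {u₁, u₂}
  have hu1 : u₁ ∈ W := Submodule.subset_span (by simp)
  have hu2 : u₂ ∈ W := Submodule.subset_span (by simp)
  have hW : ∀ w ∈ W, T w ∈ W := by
    intro w hw
    obtain ⟨α, β, rfl⟩ := Submodule.mem_span_pair.1 hw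
    rw [map_add, map_smul, map_smul, e1, e2]
    exact W.add_mem (W.smul_mem _ (W.smul_mem _ hu1)) (W.smul_mem _ (W.smul_mem _ hu2))
  obtain ⟨v, hvU, hv0, hv⟩ := exists_ne_zero_mem_inner_eq_zero hU u₁
  set α : ℝ := inner ℝ u₂ v with hα
  set w := v - α • u₂ with hw
  have hwW : w ∈ Wᗮ := by
    rw [Submodule.mem_orthogonal]
    intro y hy
    obtain ⟨s, t, rfl⟩ := Submodule.mem_span_pair.1 hy
    simp only [hw, inner_add_left, inner_sub_right, inner_smul_left, inner_smul_right, hv, h12,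
      real_inner_self_eq_norm_sq, h2, ← hα]
    simp; ring
  have hww := hT.inner_le_on_orthogonal hW h hwW
  have huw : inner ℝ u₂ w = (0 : ℝ) := hwW _ hu2
  have hv' : v = α • u₂ + w := by simp [hw]
  have hTw : inner ℝ (T w) u₂ = (0 : ℝ) := by
    rw [hT, e2, inner_smul_right, real_inner_comm, huw, mul_zero]
  have hTv : inner ℝ (T v) v = α ^ 2 * μ₂ + inner ℝ (T w) w := by
    rw [hv', map_add, map_smul, e2]
    simp only [inner_add_left, inner_add_right, inner_smul_left, inner_smul_right, hTw, huw,
      real_inner_self_eq_norm_sq, h2]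
    simp; ring
  have hnv : ‖v‖ ^ 2 = α ^ 2 + ‖w‖ ^ 2 := by
    rw [← real_inner_self_eq_norm_sq v, ← real_inner_self_eq_norm_sq w]
    conv_lhs => rw [hv']
    simp only [inner_add_left, inner_add_right, inner_smul_left, inner_smul_right, huw,
      real_inner_self_eq_norm_sq u₂, h2, real_inner_comm u₂ w]
    simp; ring
  have h3 := hg v hvU
  have h4 : 0 < ‖v‖ ^ 2 := by positivity
  have h5 : g * ‖v‖ ^ 2 ≤ μ₂ * ‖v‖ ^ 2 := by
    rw [hTv] at h3; rw [hnv, mul_add] at h3 ⊢; linarith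
  exact le_of_mul_le_mul_right h5 h4

open Submodule in
/-- If two subspaces of equal dimension are such that vectors of `W` are `δ`-close to `U`, the
difference of the orthogonal projections is small. -/
lemma norm_starProjection_sub_le {U W : Submodule ℝ E}
    (hd : Module.finrank ℝ U = Module.finrank ℝ W) {δ : ℝ} (hδ : 0 ≤ δ) (hδ' : δ ≤ 1 / 2)
    (h : ∀ w ∈ W, ‖w - U.starProjection w‖ ≤ δ * ‖w‖) :
    ‖U.starProjection - W.starProjection‖ ≤ 3 * δ := by
  let φ : W →ₗ[ℝ] U := U.orthogonalProjectionOnto.toLinearMap.comp W.subtype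
  have hlow : ∀ w ∈ W, ‖w‖ ≤ 2 * ‖U.starProjection w‖ := fun w hw => by
    have h1 := h w hw
    have h2 := norm_sub_norm_le w (U.starProjection w)
    nlinarith [norm_nonneg w]
  have hinj : Function.Injective φ := by
    rw [← LinearMap.ker_eq_bot, LinearMap.ker_eq_bot']
    intro w hw
    have h1 : U.starProjection (w : E) = 0 := by
      have := congrArg Subtype.val hw
      simpa [φ] using this
    have h2 := hlow w w.2
    rw [h1] at h2
    have : ‖(w : E)‖ = 0 := le_antisymm (by simpa using h2) (norm_nonneg _)
    simpa using this
  have hsurj : Function.Surjective φ :=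
    (LinearMap.injective_iff_surjective_of_finrank_eq_finrank hd.symm).1 hinj
  have h' : ∀ u ∈ U, ‖u - W.starProjection u‖ ≤ 2 * δ * ‖u‖ := by
    intro u hu
    obtain ⟨w, hw⟩ := hsurj ⟨u, hu⟩
    have hw' : U.starProjection (w : E) = u := by
      have := congrArg Subtype.val hw
      simpa [φ] using this
    have h1 : u - W.starProjection u = Wᗮ.starProjection (u - w) := by
      rw [starProjection_orthogonal_val, map_sub, starProjection_eq_self_iff.2 w.2]
      abel
    rw [h1]
    have h3 := h w w.2
    have h4 := hlow w w.2
    rw [hw'] at h3 h4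
    calc _ ≤ ‖u - w‖ := norm_starProjection_apply_le _ _
      _ ≤ δ * ‖(w : E)‖ := by rw [norm_sub_rev]; exact h3
      _ ≤ δ * (2 * ‖u‖) := by gcongr
      _ = _ := by ring
  refine ContinuousLinearMap.opNorm_le_bound _ (by positivity) fun x => ?_
  set w := W.starProjection x with hw
  set z := x - w with hz
  have hzW : z ∈ Wᗮ := sub_starProjection_mem_orthogonal x
  have hzU : ‖U.starProjection z‖ ≤ 2 * δ * ‖z‖ := by
    set u := U.starProjection z with hu
    have h1 : ‖u‖ ^ 2 = inner ℝ (u - W.starProjection u) z := by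
      rw [inner_sub_left, hzW _ (starProjection_apply_mem W u), sub_zero,
        ← real_inner_self_eq_norm_sq]
      nth_rewrite 2 [hu]
      rw [← inner_starProjection_left_eq_right,
        starProjection_eq_self_iff.2 (starProjection_apply_mem U z)]
    have h2 := real_inner_le_norm (u - W.starProjection u) z
    have h3 := h' u (starProjection_apply_mem U z)
    by_cases hu0 : ‖u‖ = 0
    · rw [hu0]; positivity
    · have h4 : 0 < ‖u‖ := lt_of_le_of_ne (norm_nonneg _) (Ne.symm hu0)
      refine le_of_mul_le_mul_left ?_ h4
      nlinarith [norm_nonneg z]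
  have hxz : ‖z‖ ≤ ‖x‖ := by
    have : z = Wᗮ.starProjection x := by rw [starProjection_orthogonal_val]
    rw [this]; exact norm_starProjection_apply_le _ _
  have hxw : ‖w‖ ≤ ‖x‖ := norm_starProjection_apply_le _ _
  have hsplit : (U.starProjection - W.starProjection) x
      = U.starProjection z - (w - U.starProjection w) := by
    rw [sub_apply, ← hw, hz, map_sub]; abel
  rw [hsplit]
  have h5 := h w (starProjection_apply_mem W x)
  calc _ ≤ ‖U.starProjection z‖ + ‖w - U.starProjection w‖ := norm_sub_le _ _
    _ ≤ 2 * δ * ‖z‖ + δ * ‖w‖ := add_le_add hzU h5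
    _ ≤ 2 * δ * ‖x‖ + δ * ‖x‖ := by gcongr
    _ = _ := by ring

open Submodule in
/-- A Davis–Kahan type bound: if `T` is close to an operator `F` whose range is contained in the
two-dimensional space `U` and which is at least `g` there, the top two eigenspace of `T` is
close to `U`. -/
lemma norm_starProjection_sub_le_of_top_two {T F : E →ₗ[ℝ] E} (hT : T.IsSymmetric)
    {U : Submodule ℝ E} (hU : Module.finrank ℝ U = 2) (hFU : ∀ x, F x ∈ U) {g η c : ℝ}
    (hg : ∀ x ∈ U, g * ‖x‖ ^ 2 ≤ inner ℝ (F x) x) (hTF : ∀ x, ‖T x - F x‖ ≤ η * ‖x‖)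
    (hg0 : 0 < g) (hη : 0 ≤ η) (hc : c ≤ 1) (hηc : 12 * η ≤ c * g)
    {u₁ u₂ : E} {μ₁ μ₂ : ℝ} (h12 : inner ℝ u₁ u₂ = (0 : ℝ)) (h1 : ‖u₁‖ = 1) (h2 : ‖u₂‖ = 1)
    (e1 : T u₁ = μ₁ • u₁) (e2 : T u₂ = μ₂ • u₂)
    (h : ∀ (μ : ℝ) (v : E), v ≠ 0 → v ∈ (span ℝ {u₁, u₂})ᗮ → T v = μ • v → μ ≤ min μ₁ μ₂) :
    ‖U.starProjection - (span ℝ {u₁, u₂}).starProjection‖ ≤ c := by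
  have hgT : ∀ x ∈ U, (g - η) * ‖x‖ ^ 2 ≤ inner ℝ (T x) x := fun x hx => by
    have h3 : inner ℝ (T x) x = inner ℝ (F x) x + inner ℝ (T x - F x) x := by
      rw [← inner_add_left]; congr 1; abel
    have h4 := abs_real_inner_le_norm (T x - F x) x
    have h5 := (abs_le.1 h4).1
    nlinarith [hg x hx, hTF x, norm_nonneg x]
  have hg2 : g / 2 ≤ g - η := by nlinarith
  have hμ2 : g / 2 ≤ μ₂ := hg2.trans <| le_of_top_two hT hU hgT h12 h2 e1 e2
    fun μ v hv0 hv hTv => (h μ v hv0 hv hTv).trans (min_le_right _ _)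
  have hμ1 : g / 2 ≤ μ₁ := hg2.trans <|
    le_of_top_two hT hU hgT (by rw [real_inner_comm]; exact h12) h1 e2 e1
    fun μ v hv0 hv hTv => (h μ v hv0 (by rwa [Set.pair_comm]) hTv).trans (min_le_left _ _)
  have hon : Orthonormal ℝ ![u₁, u₂] := by
    rw [orthonormal_iff_ite]
    intro i j
    fin_cases i <;> fin_cases j <;>
      simp [h12, h1, h2, real_inner_comm u₁ u₂]
  have hfin : Module.finrank ℝ (span ℝ {u₁, u₂}) = 2 := by
    have := finrank_span_eq_card hon.linearIndependent
    rwa [Matrix.range_cons_cons_empty, Fintype.card_fin] at this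
  have hpyth : ∀ s t : ℝ, ‖s • u₁ + t • u₂‖ ^ 2 = s ^ 2 + t ^ 2 := fun s t => by
    rw [← real_inner_self_eq_norm_sq]
    simp only [inner_add_left, inner_add_right, inner_smul_left, inner_smul_right, h12,
      real_inner_self_eq_norm_sq, h1, h2, real_inner_comm u₁ u₂]
    simp; ring
  have hmain := norm_starProjection_sub_le (U := U) (W := span ℝ {u₁, u₂}) (δ := 2 * η / g)
    (by rw [hU, hfin]) (by positivity) (by rw [div_le_iff₀ hg0]; nlinarith) ?_
  · refine hmain.trans ?_
    rw [← mul_div_assoc, div_le_iff₀ hg0]; nlinarith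
  intro w hw
  obtain ⟨α, β, rfl⟩ := mem_span_pair.1 hw
  have p1 : 0 < μ₁ := by linarith
  have p2 : 0 < μ₂ := by linarith
  set w := α • u₁ + β • u₂ with hwdef
  set y := (α / μ₁) • u₁ + (β / μ₂) • u₂ with hy
  have hTy : T y = w := by
    rw [hy, map_add, map_smul, map_smul, e1, e2, smul_smul, smul_smul, div_mul_cancel₀ _ p1.ne',
      div_mul_cancel₀ _ p2.ne']
  have hny : ‖y‖ ≤ 2 / g * ‖w‖ := by
    refine (pow_le_pow_iff_left₀ (norm_nonneg _) (by positivity) two_ne_zero).1 ?_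
    rw [mul_pow, hpyth, hpyth, mul_add, div_pow, div_pow]
    have key : ∀ x μ : ℝ, g / 2 ≤ μ → x ^ 2 / μ ^ 2 ≤ (2 / g) ^ 2 * x ^ 2 := fun x μ hμ => by
      have : 1 / μ ≤ 2 / g := by
        rw [div_le_div_iff₀ (by linarith) hg0]; linarith
      have h6 : (1 / μ) ^ 2 ≤ (2 / g) ^ 2 :=
        pow_le_pow_left₀ (by have : 0 < μ := by linarith
                             positivity) this 2
      calc x ^ 2 / μ ^ 2 = (1 / μ) ^ 2 * x ^ 2 := by ring
        _ ≤ _ := by gcongr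
    exact add_le_add (key _ _ hμ1) (key _ _ hμ2)
  have hproj : w - U.starProjection w = Uᗮ.starProjection (T y - F y) := by
    rw [starProjection_orthogonal_val, map_sub, starProjection_eq_self_iff.2 (hFU y), hTy]
    abel
  rw [hproj]
  calc _ ≤ ‖T y - F y‖ := norm_starProjection_apply_le _ _
    _ ≤ η * ‖y‖ := hTF y
    _ ≤ η * (2 / g * ‖w‖) := by gcongr
    _ = _ := by ring

end Perturbation

section Chernoff

/-- Presence of an edge as a real number. -/
noncomputable def edgeInd {N : ℕ} (ω : Config N) (e : EdgeIdx N) : ℝ := if ω e then 1 else 0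

/-- Exponent whose exponential has mean at most `1` under independent edges of probability `p`. -/
noncomputable def edgeExponent {N : ℕ} (p θ : EdgeIdx N → ℝ) (ω : Config N) : ℝ :=
  ∑ e, (θ e * edgeInd ω e - p e * (Real.exp (θ e) - 1))

lemma integral_bern {p : ℝ} (hp0 : 0 ≤ p) (hp1 : p ≤ 1) (f : Bool → ℝ) :
    ∫ x, f x ∂(bern p) = p * f true + (1 - p) * f false := by
  unfold bern
  rw [PMF.integral_eq_sum]
  simp [hp0, PMF.bernoulli_apply, hp1]

lemma integral_exp_edgeExponent_le {N : ℕ} {p : EdgeIdx N → ℝ} (hp0 : ∀ e, 0 ≤ p e)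
    (hp1 : ∀ e, p e ≤ 1) (θ : EdgeIdx N → ℝ) :
    ∫ ω, Real.exp (edgeExponent p θ ω) ∂(Measure.pi fun e => bern (p e)) ≤ 1 := by
  let G : EdgeIdx N → Bool → ℝ := fun e x =>
    Real.exp (θ e * (if x then 1 else 0) - p e * (Real.exp (θ e) - 1))
  have h : ∀ ω : Config N, Real.exp (edgeExponent p θ ω) = ∏ e, G e (ω e) := fun ω => by
    rw [edgeExponent, Real.exp_sum]; rfl
  simp_rw [h]
  rw [integral_fintype_prod_eq_prod (μ := fun e => bern (p e)) G]
  refine Finset.prod_le_one (fun e _ => integral_nonneg fun x => (Real.exp_pos _).le) fun e _ => ?_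
  rw [integral_bern (hp0 e) (hp1 e)]
  set c := p e * (Real.exp (θ e) - 1)
  have ht : G e true = Real.exp (θ e) * Real.exp (-c) := by
    rw [← Real.exp_add]; simp [G, c, sub_eq_add_neg]
  have hf : G e false = Real.exp (-c) := by simp [G, c]
  have h1 := Real.add_one_le_exp c
  have h2 : Real.exp (-c) * Real.exp c = 1 := by rw [← Real.exp_add]; simp
  rw [ht, hf]
  calc _ = Real.exp (-c) * (p e * (Real.exp (θ e) - 1) + 1) := by ring
    _ = Real.exp (-c) * (c + 1) := rfl
    _ ≤ Real.exp (-c) * Real.exp c := by gcongr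
    _ = 1 := h2

/-- Union bound for a finite family of Chernoff estimates. -/
lemma measureReal_exists_lt_edgeExponent_le {N : ℕ} {p : EdgeIdx N → ℝ} (hp0 : ∀ e, 0 ≤ p e)
    (hp1 : ∀ e, p e ≤ 1) {ι : Type*} (F : Finset ι) (θ : ι → EdgeIdx N → ℝ) (g : ι → ℝ) :
    (Measure.pi fun e => bern (p e)).real {ω | ∃ i ∈ F, g i < edgeExponent p (θ i) ω}
      ≤ ∑ i ∈ F, Real.exp (-g i) := by
  set μ : Measure (Config N) := Measure.pi fun e => bern (p e) with hμ
  have hset : {ω | ∃ i ∈ F, g i < edgeExponent p (θ i) ω}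
      = ⋃ i ∈ F, {ω | g i < edgeExponent p (θ i) ω} := by
    ext ω; simp
  rw [hset]
  refine (measureReal_biUnion_finset_le F _).trans (Finset.sum_le_sum fun i _ => ?_)
  have hint : Integrable (fun ω => Real.exp (edgeExponent p (θ i) ω)) μ := Integrable.of_finite
  have h1 := mul_meas_ge_le_integral_of_nonneg (μ := μ)
    (Eventually.of_forall fun ω => (Real.exp_pos (edgeExponent p (θ i) ω)).le) hint
    (Real.exp (g i))
  have h2 := h1.trans (integral_exp_edgeExponent_le hp0 hp1 (θ i))
  have h3 : μ.real {ω | g i < edgeExponent p (θ i) ω}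
      ≤ μ.real {ω | Real.exp (g i) ≤ Real.exp (edgeExponent p (θ i) ω)} :=
    measureReal_mono fun ω hω => Real.exp_le_exp.2 (le_of_lt hω)
  refine h3.trans ?_
  rw [Real.exp_neg, ← one_div, le_div_iff₀ (Real.exp_pos _), mul_comm]
  exact h2

end Chernoff

section PairSums

lemma edgeInd_nonneg {N : ℕ} (ω : Config N) (e : EdgeIdx N) : 0 ≤ edgeInd ω e := by
  unfold edgeInd; split_ifs <;> norm_num

lemma adjOf_comm {N : ℕ} (ω : Config N) (i j : Fin N) : adjOf ω i j = adjOf ω j i := by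
  unfold adjOf
  rcases lt_trichotomy i j with h | h | h
  · simp [h, h.not_gt]
  · simp [h]
  · simp [h, h.not_gt]

lemma adjOf_edge {N : ℕ} (ω : Config N) (e : EdgeIdx N) : adjOf ω e.1.1 e.1.2 = ω e := by
  simp [adjOf, e.2]

lemma adjMat_edge {N : ℕ} (ω : Config N) (e : EdgeIdx N) :
    adjMat ω e.1.1 e.1.2 = edgeInd ω e := by
  simp [adjMat, edgeInd, adjOf_edge]

lemma adjMat_comm {N : ℕ} (ω : Config N) (i j : Fin N) : adjMat ω i j = adjMat ω j i := by
  simp only [adjMat, adjOf_comm ω i j]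

lemma adjMat_self {N : ℕ} (ω : Config N) (i : Fin N) : adjMat ω i i = 0 := by
  simp [adjMat, adjOf]

/-- A double sum over vertices is a sum over unordered pairs when the diagonal vanishes. -/
lemma sum_sum_eq_sum_edge {N : ℕ} (f : Fin N → Fin N → ℝ) (hf : ∀ i, f i i = 0) :
    ∑ i, ∑ j, f i j = ∑ e : EdgeIdx N, (f e.1.1 e.1.2 + f e.1.2 e.1.1) := by
  have h1 : ∀ g : Fin N × Fin N → ℝ,
      ∑ e : EdgeIdx N, g e.1 = ∑ x : Fin N × Fin N, if x.1 < x.2 then g x else 0 := fun g => by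
    rw [← Finset.sum_filter]
    exact (Finset.sum_subtype _ (by simp) g).symm
  rw [Finset.sum_add_distrib, h1 fun x => f x.1 x.2, h1 fun x => f x.2 x.1,
    ← Equiv.sum_comp (Equiv.prodComm (Fin N) (Fin N)) fun x => if x.1 < x.2 then f x.2 x.1 else 0,
    ← Finset.sum_add_distrib, ← Fintype.sum_prod_type']
  refine Finset.sum_congr rfl fun x _ => ?_
  rcases lt_trichotomy x.1 x.2 with h | h | h
  · simp [h, h.not_gt]
  · simp [h, hf]
  · simp [h, h.not_gt]

lemma degOf_eq_sum {N : ℕ} (ω : Config N) (v : Fin N) : (degOf ω v : ℝ) = ∑ j, adjMat ω v j := by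
  simp [degOf, adjMat]

/-- Handshake identity with vertex weights. -/
lemma sum_edge_add_mul_edgeInd {N : ℕ} (ω : Config N) (f : Fin N → ℝ) :
    ∑ e : EdgeIdx N, (f e.1.1 + f e.1.2) * edgeInd ω e = ∑ v, f v * degOf ω v := by
  simp_rw [degOf_eq_sum, Finset.mul_sum]
  rw [sum_sum_eq_sum_edge _ fun i => by simp [adjMat_self]]
  refine Finset.sum_congr rfl fun e _ => ?_
  rw [adjMat_comm ω e.1.2, adjMat_edge]; ring

lemma sum_edge_add_le {N : ℕ} {f : Fin N → ℝ} (hf : ∀ v, 0 ≤ f v) :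
    ∑ e : EdgeIdx N, (f e.1.1 + f e.1.2) ≤ N * ∑ v, f v := by
  have h := sum_sum_eq_sum_edge (fun i j => if i = j then 0 else f i) (by simp)
  have h2 : ∑ e : EdgeIdx N, (f e.1.1 + f e.1.2)
      = ∑ i, ∑ j : Fin N, if i = j then 0 else f i := by
    rw [h]
    exact Finset.sum_congr rfl fun e _ => by simp [e.2.ne, e.2.ne']
  rw [h2, Finset.mul_sum]
  refine Finset.sum_le_sum fun i _ => ?_
  calc _ ≤ ∑ j : Fin N, f i := Finset.sum_le_sum fun j _ => by split_ifs <;> simp [hf]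
    _ = _ := by simp

lemma two_mul_sum_edge_mul_le {N : ℕ} {f : Fin N → ℝ} (hf : ∀ v, 0 ≤ f v) :
    2 * ∑ e : EdgeIdx N, f e.1.1 * f e.1.2 ≤ (∑ v, f v) ^ 2 := by
  have h := sum_sum_eq_sum_edge (fun i j => if i = j then 0 else f i * f j) (by simp)
  have h2 : 2 * ∑ e : EdgeIdx N, f e.1.1 * f e.1.2
      = ∑ i, ∑ j : Fin N, if i = j then 0 else f i * f j := by
    rw [h, Finset.mul_sum]
    exact Finset.sum_congr rfl fun e _ => by simp [e.2.ne, e.2.ne']; ring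
  rw [h2, sq, Finset.sum_mul_sum]
  refine Finset.sum_le_sum fun i _ => Finset.sum_le_sum fun j _ => ?_
  split_ifs
  · exact mul_nonneg (hf _) (hf _)
  · exact le_rfl

end PairSums

section HeavyEdges

lemma exp_mul_le_of_le_one {j : ℕ} {s : ℝ} (hj : 1 ≤ j) (hs : s ≤ 1) (h : 1 ≤ 4 ^ j * s) :
    Real.exp (j * s) ≤ 3 * (4 ^ j * s) := by
  have he : Real.exp 1 < 2.7182818286 := Real.exp_one_lt_d9
  have hj' : (1 : ℝ) ≤ j := by exact_mod_cast hj
  rcases le_total (j * s) 1 with h1 | h1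
  · have := Real.exp_le_exp.2 h1
    linarith
  · have h2 : Real.exp (j * s) ≤ Real.exp 1 ^ j := by
      rw [← Real.exp_nat_mul, Real.exp_le_exp]
      gcongr
    have h3 : 1 + (j : ℝ) * (2 / 5) ≤ (1 + 2 / 5) ^ j := one_add_mul_le_pow (by norm_num) j
    have h4 : Real.exp 1 ^ j * (1 + 2 / 5) ^ j ≤ 4 ^ j := by
      rw [← mul_pow]
      exact pow_le_pow_left₀ (by positivity) (by linarith) j
    have h5 : Real.exp 1 ^ j * (j * (1 / 3)) ≤ 4 ^ j :=
      (mul_le_mul_of_nonneg_left (by linarith) (by positivity)).trans h4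
    have h6 : (j : ℝ) * Real.exp 1 ^ j ≤ j * (3 * (4 ^ j * s)) := by
      calc (j : ℝ) * Real.exp 1 ^ j = 3 * (Real.exp 1 ^ j * (j * (1 / 3))) := by ring
        _ ≤ 3 * 4 ^ j * 1 := by linarith
        _ ≤ 3 * 4 ^ j * (j * s) := by gcongr
        _ = _ := by ring
    exact h2.trans (le_of_mul_le_mul_left h6 (by linarith))

lemma sum_four_pow_div_le (m : ℕ) :
    ∑ j ∈ Finset.Icc 1 m, (4 : ℝ) ^ j / j ≤ 4 * (4 ^ m / m) := by
  induction m with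
  | zero => simp
  | succ m ih =>
    rw [Finset.sum_Icc_succ_top (by omega)]
    rcases Nat.eq_zero_or_pos m with rfl | hm
    · norm_num
    · have hm' : (1 : ℝ) ≤ m := by exact_mod_cast hm
      have h1 : (4 : ℝ) * (4 ^ m / m) ≤ 3 * (4 ^ (m + 1) / ((m + 1 : ℕ) : ℝ)) := by
        push_cast
        rw [pow_succ, ← mul_div_assoc, ← mul_div_assoc,
          div_le_div_iff₀ (by linarith) (by linarith)]
        have : (0 : ℝ) < 4 ^ m := by positivity
        nlinarith
      linarith

/-- Product of the dyadic sizes at the endpoints of an edge. -/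
noncomputable def levelProd {N : ℕ} (L : Fin N → ℕ) (e : EdgeIdx N) : ℝ :=
  2 ^ (L e.1.1 + L e.1.2)

/-- Exponents used for the heavy edges whose lower endpoint has level `j`. -/
noncomputable def levelExponent {N : ℕ} (d : ℝ) (L : Fin N → ℕ) (j : ℕ) (e : EdgeIdx N) : ℝ :=
  if min (L e.1.1) (L e.1.2) = j ∧ √d ≤ levelProd L e ∧ levelProd L e ≤ √d * 4 ^ j then
    j / (√d * 4 ^ j) * levelProd L e else 0

/-- Squared dyadic size of a vertex, with the convention that level `0` means size `0`. -/
noncomputable def levelSq {N : ℕ} (L : Fin N → ℕ) (v : Fin N) : ℝ :=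
  if L v = 0 then 0 else 4 ^ L v

lemma levelSq_nonneg {N : ℕ} (L : Fin N → ℕ) (v : Fin N) : 0 ≤ levelSq L v := by
  unfold levelSq; split_ifs <;> positivity

lemma levelExponent_nonneg {N : ℕ} (d : ℝ) (L : Fin N → ℕ) (j : ℕ) (e : EdgeIdx N) :
    0 ≤ levelExponent d L j e := by
  unfold levelExponent levelProd; split_ifs <;> positivity

lemma levelProd_sq {N : ℕ} {L : Fin N → ℕ} {e : EdgeIdx N} (h1 : L e.1.1 ≠ 0)
    (h2 : L e.1.2 ≠ 0) : levelProd L e ^ 2 = levelSq L e.1.1 * levelSq L e.1.2 := by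
  rw [levelProd, levelSq, levelSq, if_neg h1, if_neg h2, ← pow_mul, mul_comm, pow_mul, pow_add]
  norm_num

/-- Heavy edges are either controlled by degrees or by one of the level sums. -/
lemma heavy_edge_le {N : ℕ} {d : ℝ} (hd : 0 < d) {L : Fin N → ℕ} {M : ℕ} (hL : ∀ v, L v ≤ M)
    {e : EdgeIdx N} (h1 : L e.1.1 ≠ 0) (h2 : L e.1.2 ≠ 0) (h : √d ≤ levelProd L e) :
    levelProd L e ≤ (levelSq L e.1.1 + levelSq L e.1.2) / √d +
      ∑ j ∈ Finset.Icc 1 M, √d * (4 ^ j / j) * levelExponent d L j e := by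
  have hs : 0 < √d := Real.sqrt_pos.2 hd
  have hnn : ∀ j ∈ Finset.Icc 1 M, 0 ≤ √d * (4 ^ j / j) * levelExponent d L j e := fun j _ =>
    mul_nonneg (by positivity) (levelExponent_nonneg d L j e)
  have hQ : 0 < levelProd L e := by unfold levelProd; positivity
  set m := min (L e.1.1) (L e.1.2) with hm
  have hm1 : 1 ≤ m := by omega
  have hm0 : (0 : ℝ) < m := by exact_mod_cast hm1
  rcases le_or_gt (levelProd L e) (√d * 4 ^ m) with h3 | h3
  · have hmem : m ∈ Finset.Icc 1 M :=
      Finset.mem_Icc.2 ⟨hm1, (min_le_left _ _).trans (hL _)⟩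
    have h4 := Finset.single_le_sum hnn hmem
    have h5 : √d * (4 ^ m / m) * levelExponent d L m e = levelProd L e := by
      rw [levelExponent, if_pos ⟨rfl, h, h3⟩]; field_simp
    rw [h5] at h4
    have h6 : 0 ≤ (levelSq L e.1.1 + levelSq L e.1.2) / √d :=
      div_nonneg (add_nonneg (levelSq_nonneg _ _) (levelSq_nonneg _ _)) hs.le
    linarith
  · have h4 := Finset.sum_nonneg hnn
    have h5 : levelProd L e ≤ (levelSq L e.1.1 + levelSq L e.1.2) / √d := by
      rw [le_div_iff₀ hs]
      have h6 : levelProd L e ^ 2 ≤ (levelSq L e.1.1 + levelSq L e.1.2) * 4 ^ m := by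
        rw [levelProd_sq h1 h2]
        have e1 : levelSq L e.1.1 = 4 ^ L e.1.1 := if_neg h1
        have e2 : levelSq L e.1.2 = 4 ^ L e.1.2 := if_neg h2
        have p1 : (0 : ℝ) < 4 ^ L e.1.1 := by positivity
        have p2 : (0 : ℝ) < 4 ^ L e.1.2 := by positivity
        rw [e1, e2]
        rcases min_choice (L e.1.1) (L e.1.2) with h7 | h7 <;> rw [hm, h7] <;> nlinarith
      have h8 : (levelProd L e * √d) * 4 ^ m ≤ (levelSq L e.1.1 + levelSq L e.1.2) * 4 ^ m := by
        nlinarith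
      exact le_of_mul_le_mul_right h8 (by positivity)
    linarith

lemma level_mean_le {N : ℕ} {d : ℝ} (hd : 0 < d) {p : EdgeIdx N → ℝ} (hp : ∀ e, p e ≤ 2 * d / N)
    {L : Fin N → ℕ} {j : ℕ} (hj : 1 ≤ j) (e : EdgeIdx N) :
    √d * (4 ^ j / j) * (p e * (Real.exp (levelExponent d L j e) - 1)) ≤
      if min (L e.1.1) (L e.1.2) = j then 6 * √d / N * (levelSq L e.1.1 * levelSq L e.1.2)
      else 0 := by
  have hs : 0 < √d := Real.sqrt_pos.2 hd
  have hj' : (1 : ℝ) ≤ j := by exact_mod_cast hj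
  have hrhs : (0 : ℝ) ≤ 6 * √d / N * (levelSq L e.1.1 * levelSq L e.1.2) :=
    mul_nonneg (by positivity) (mul_nonneg (levelSq_nonneg _ _) (levelSq_nonneg _ _))
  by_cases hmin : min (L e.1.1) (L e.1.2) = j
  swap
  · rw [levelExponent, if_neg (fun h => hmin h.1), if_neg hmin]; simp
  rw [if_pos hmin]
  by_cases h : √d ≤ levelProd L e ∧ levelProd L e ≤ √d * 4 ^ j
  swap
  · rw [levelExponent, if_neg (fun h' => h h'.2)]; simpa using hrhs
  rw [levelExponent, if_pos ⟨hmin, h⟩, ← levelProd_sq (by omega) (by omega)]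
  set Q := levelProd L e
  set s := Q / (√d * 4 ^ j) with hsdef
  have hQ : 0 < Q := hs.trans_le h.1
  have e1 : (j : ℝ) / (√d * 4 ^ j) * Q = j * s := by rw [hsdef]; ring
  have e2 : 4 ^ j * s = Q / √d := by rw [hsdef]; field_simp
  have hs0 : 0 < s := by positivity
  have h1 : Real.exp (j * s) ≤ 3 * (4 ^ j * s) := by
    refine exp_mul_le_of_le_one hj ?_ ?_
    · rw [hsdef, div_le_one (by positivity)]; exact h.2
    · rw [e2, le_div_iff₀ hs, one_mul]; exact h.1
  have h2 : Real.exp (j * s) - 1 ≤ j * s * Real.exp (j * s) := by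
    have h3 := Real.add_one_le_exp (-(j * s))
    have h4 : Real.exp (-(j * s)) * Real.exp (j * s) = 1 := by rw [← Real.exp_add]; simp
    nlinarith [Real.exp_pos (j * s)]
  rw [e1]
  have h0 : 0 ≤ Real.exp (j * s) - 1 := by
    have : 0 ≤ j * s := by positivity
    linarith [Real.add_one_le_exp (j * s)]
  calc √d * (4 ^ j / j) * (p e * (Real.exp (j * s) - 1))
      ≤ √d * (4 ^ j / j) * (2 * d / N * (j * s * (3 * (4 ^ j * s)))) := by
        gcongr
        · exact hp e
        · exact h2.trans (by gcongr)
    _ = 6 * √d * d / N * (4 ^ j * s) ^ 2 := by field_simp; ring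
    _ = 6 * √d / N * (Q ^ 2 * (d / √d ^ 2)) := by rw [e2]; ring
    _ = _ := by rw [Real.sq_sqrt hd.le, div_self hd.ne', mul_one]

lemma heavy_sum_le {N : ℕ} {d : ℝ} (hd : 0 < d) {p : EdgeIdx N → ℝ}
    (hp : ∀ e, p e ≤ 2 * d / N) {ω : Config N} {L : Fin N → ℕ} {M : ℕ} (hL : ∀ v, L v ≤ M)
    (hM : (4 : ℝ) ^ M ≤ 64 * N) (hdeg : ∀ v, L v ≠ 0 → (degOf ω v : ℝ) ≤ 20 * d)
    (hsum : ∑ v, levelSq L v ≤ 64 * N)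
    (hlev : ∀ j ∈ Finset.Icc 1 M, edgeExponent p (levelExponent d L j) ω ≤
      ∑ v, (if j ≤ L v then 3 * (L v : ℝ) else 0) + 2 * N / 16 ^ j + M) :
    ∑ e : EdgeIdx N, (if L e.1.1 ≠ 0 ∧ L e.1.2 ≠ 0 ∧ √d ≤ levelProd L e then
      levelProd L e * edgeInd ω e else 0) ≤ 15000 * (√d * N) := by
  have hs : 0 < √d := Real.sqrt_pos.2 hd
  have hN : (0 : ℝ) ≤ N := Nat.cast_nonneg N
  have hterm : ∀ e : EdgeIdx N, (if L e.1.1 ≠ 0 ∧ L e.1.2 ≠ 0 ∧ √d ≤ levelProd L e then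
      levelProd L e * edgeInd ω e else 0) ≤
      1 / √d * ((levelSq L e.1.1 + levelSq L e.1.2) * edgeInd ω e) +
      ∑ j ∈ Finset.Icc 1 M, √d * (4 ^ j / j) * (levelExponent d L j e * edgeInd ω e) := by
    intro e
    have hX := edgeInd_nonneg ω e
    split_ifs with h
    · have h1 := mul_le_mul_of_nonneg_right (heavy_edge_le hd hL h.1 h.2.1 h.2.2) hX
      rw [add_mul, Finset.sum_mul] at h1
      refine h1.trans (le_of_eq ?_)
      congr 1
      · ring
      · exact Finset.sum_congr rfl fun j _ => by ring
    · refine add_nonneg (mul_nonneg (by positivity) (mul_nonneg (add_nonneg (levelSq_nonneg _ _)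
        (levelSq_nonneg _ _)) hX)) (Finset.sum_nonneg fun j _ => ?_)
      exact mul_nonneg (by positivity) (mul_nonneg (levelExponent_nonneg _ _ _ _) hX)
  refine (Finset.sum_le_sum fun e _ => hterm e).trans ?_
  rw [Finset.sum_add_distrib, ← Finset.mul_sum, sum_edge_add_mul_edgeInd, Finset.sum_comm]
  have hA : 1 / √d * ∑ v, levelSq L v * degOf ω v ≤ 1280 * (√d * N) := by
    have h1 : ∑ v, levelSq L v * degOf ω v ≤ 20 * d * (64 * N) := by
      calc _ ≤ ∑ v, 20 * d * levelSq L v := Finset.sum_le_sum fun v _ => by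
            by_cases h : L v = 0
            · simp [levelSq, h]
            · rw [mul_comm]
              exact mul_le_mul_of_nonneg_right (hdeg v h) (levelSq_nonneg _ _)
        _ = 20 * d * ∑ v, levelSq L v := by rw [Finset.mul_sum]
        _ ≤ _ := by gcongr
    calc _ ≤ 1 / √d * (20 * d * (64 * N)) := by gcongr
      _ = 1280 * (1 / √d * d * N) := by ring
      _ = 1280 * (√d * N) := by rw [one_div, inv_mul_eq_div, Real.div_sqrt]
  have hB : ∀ j ∈ Finset.Icc 1 M,
      ∑ e, √d * (4 ^ j / j) * (levelExponent d L j e * edgeInd ω e) ≤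
      √d * (4 ^ j / j) * (∑ v, (if j ≤ L v then 3 * (L v : ℝ) else 0) + 2 * N / 16 ^ j + M) +
      ∑ e : EdgeIdx N, if min (L e.1.1) (L e.1.2) = j then
        6 * √d / N * (levelSq L e.1.1 * levelSq L e.1.2) else 0 := by
    intro j hj
    have h1 := mul_le_mul_of_nonneg_left (hlev j hj)
      (by positivity : 0 ≤ √d * ((4 : ℝ) ^ j / j))
    have h2 := Finset.sum_le_sum fun e (_ : e ∈ Finset.univ) =>
      level_mean_le hd hp (L := L) (Finset.mem_Icc.1 hj).1 e
    rw [edgeExponent, Finset.sum_sub_distrib, mul_sub, Finset.mul_sum, Finset.mul_sum] at h1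
    linarith
  have hC : ∑ j ∈ Finset.Icc 1 M, (∑ e : EdgeIdx N, if min (L e.1.1) (L e.1.2) = j then
      6 * √d / N * (levelSq L e.1.1 * levelSq L e.1.2) else 0) ≤ 12288 * (√d * N) := by
    rw [Finset.sum_comm]
    have h1 : ∀ e : EdgeIdx N, (∑ j ∈ Finset.Icc 1 M, if min (L e.1.1) (L e.1.2) = j then
        6 * √d / N * (levelSq L e.1.1 * levelSq L e.1.2) else 0) ≤
        6 * √d / N * (levelSq L e.1.1 * levelSq L e.1.2) := fun e => by
      rw [Finset.sum_ite_eq]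
      split_ifs
      · exact le_rfl
      · exact mul_nonneg (by positivity) (mul_nonneg (levelSq_nonneg _ _) (levelSq_nonneg _ _))
    refine (Finset.sum_le_sum fun e _ => h1 e).trans ?_
    rw [← Finset.mul_sum]
    have h2 := two_mul_sum_edge_mul_le (levelSq_nonneg L)
    have h3 : (∑ v, levelSq L v) ^ 2 ≤ (64 * N) ^ 2 :=
      pow_le_pow_left₀ (Finset.sum_nonneg fun v _ => levelSq_nonneg L v) hsum 2
    calc _ ≤ 6 * √d / N * (2048 * N ^ 2) := by gcongr; nlinarith
      _ ≤ 12288 * (√d * N) := by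
        rcases hN.eq_or_lt with h0 | h0
        · rw [← h0]; simp
        · apply le_of_eq; field_simp; ring
  have hD : ∑ j ∈ Finset.Icc 1 M, √d * ((4 : ℝ) ^ j / j) *
      (∑ v, (if j ≤ L v then 3 * (L v : ℝ) else 0)) ≤ 768 * (√d * N) := by
    simp_rw [Finset.mul_sum]
    rw [Finset.sum_comm]
    have h1 : ∀ v, ∑ j ∈ Finset.Icc 1 M,
        √d * ((4 : ℝ) ^ j / j) * (if j ≤ L v then 3 * (L v : ℝ) else 0) ≤
        12 * √d * levelSq L v := fun v => by
      have h2 : ∑ j ∈ Finset.Icc 1 M,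
          √d * ((4 : ℝ) ^ j / j) * (if j ≤ L v then 3 * (L v : ℝ) else 0)
          = 3 * √d * L v * ∑ j ∈ Finset.Icc 1 (L v), (4 : ℝ) ^ j / j := by
        rw [Finset.mul_sum]
        have h3 : Finset.Icc 1 (L v) = (Finset.Icc 1 M).filter fun j => j ≤ L v := by
          ext j; have := hL v; simp; omega
        rw [h3, Finset.sum_filter]
        exact Finset.sum_congr rfl fun j _ => by split_ifs <;> ring
      rw [h2]
      by_cases h0 : L v = 0
      · simp [h0, levelSq]
      · have h4 : (0 : ℝ) < L v := by exact_mod_cast Nat.pos_of_ne_zero h0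
        rw [levelSq, if_neg h0]
        calc _ ≤ 3 * √d * L v * (4 * (4 ^ L v / L v)) := by
              gcongr; exact sum_four_pow_div_le _
          _ = _ := by field_simp; ring
    refine (Finset.sum_le_sum fun v _ => h1 v).trans ?_
    rw [← Finset.mul_sum]
    nlinarith
  have hE : ∑ j ∈ Finset.Icc 1 M, √d * ((4 : ℝ) ^ j / j) * (2 * N / 16 ^ j) ≤
      2 * (√d * N) := by
    have h1 : ∑ j ∈ Finset.Icc 1 M, √d * ((4 : ℝ) ^ j / j) * (2 * N / 16 ^ j)
        ≤ ∑ j ∈ Finset.Icc 1 M, 2 * (√d * N) * (1 / 4) ^ j := by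
      refine Finset.sum_le_sum fun j hj => ?_
      have hj' : (1 : ℝ) ≤ j := by exact_mod_cast (Finset.mem_Icc.1 hj).1
      have h2 : (16 : ℝ) ^ j = 4 ^ j * 4 ^ j := by rw [← mul_pow]; norm_num
      rw [h2, one_div, inv_pow]
      have h3 : √d * ((4 : ℝ) ^ j / j) * (2 * N / (4 ^ j * 4 ^ j))
          = 2 * (√d * N) * (4 ^ j)⁻¹ * (1 / j) := by field_simp
      rw [h3]
      have h4 : (1 : ℝ) / j ≤ 1 := by rw [div_le_one (by linarith)]; exact hj'
      exact mul_le_of_le_one_right (by positivity) h4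
    refine h1.trans ?_
    rw [← Finset.mul_sum]
    refine mul_le_of_le_one_right (by positivity) ?_
    have h5 : ∑ j ∈ Finset.Icc 1 M, (1 / 4 : ℝ) ^ j ≤ 1 - (1 / 4) ^ M := by
      clear * -
      induction M with
      | zero => simp
      | succ m ih =>
        rw [Finset.sum_Icc_succ_top (by omega), pow_succ]
        have : (0 : ℝ) < (1 / 4) ^ m := by positivity
        linarith
    have : (0 : ℝ) < (1 / 4) ^ M := by positivity
    linarith
  have hF : ∑ j ∈ Finset.Icc 1 M, √d * ((4 : ℝ) ^ j / j) * M ≤ 256 * (√d * N) := by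
    rw [← Finset.sum_mul, ← Finset.mul_sum]
    rcases Nat.eq_zero_or_pos M with rfl | hM0
    · simp; positivity
    · have hM' : (0 : ℝ) < M := by exact_mod_cast hM0
      calc _ ≤ √d * (4 * (4 ^ M / M)) * M := by gcongr; exact sum_four_pow_div_le M
        _ = 4 * √d * 4 ^ M := by field_simp
        _ ≤ 4 * √d * (64 * N) := by gcongr
        _ = _ := by ring
  have hsumB := Finset.sum_le_sum hB
  rw [Finset.sum_add_distrib] at hsumB
  simp_rw [mul_add, Finset.sum_add_distrib] at hsumB
  have : 0 ≤ √d * N := by positivity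
  linarith

end HeavyEdges

section QuadraticForm

/-- Exponents used for the light edges of an integral vector. -/
noncomputable def lightExponent {N : ℕ} (d σ : ℝ) (k : Fin N → ℝ) (e : EdgeIdx N) : ℝ :=
  if |k e.1.1 * k e.1.2| ≤ √d then σ * (k e.1.1 * k e.1.2) / √d else 0

lemma four_pow_size_le {z : ℕ} (hz : z ≠ 0) : 4 ^ z.size ≤ 4 * z ^ 2 := by
  have h1 : 0 < z.size := Nat.size_pos.2 (Nat.pos_of_ne_zero hz)
  have h2 : 2 ^ (z.size - 1) ≤ z := Nat.lt_size.1 (by omega)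
  obtain ⟨m, hm⟩ : ∃ m, z.size = m + 1 := ⟨z.size - 1, by omega⟩
  rw [hm] at h2 ⊢
  have h3 : 4 ^ (m + 1) = 4 * (2 ^ m) ^ 2 := by
    rw [← pow_mul, mul_comm m 2, pow_mul, pow_succ]; norm_num; ring
  rw [h3]
  gcongr
  simpa using h2

lemma levelSq_size_le {N : ℕ} (z : Fin N → ℕ) (v : Fin N) :
    levelSq (fun v => (z v).size) v ≤ 4 * (z v : ℝ) ^ 2 := by
  unfold levelSq
  split_ifs with h
  · positivity
  · have : z v ≠ 0 := fun h0 => h (by simp [h0])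
    exact_mod_cast four_pow_size_le this

lemma sum_edge_sq_mul_sq_le {N : ℕ} {z : Fin N → ℕ} (hz : ∑ v, (z v : ℝ) ^ 2 ≤ 16 * N) :
    ∑ e : EdgeIdx N, ((z e.1.1 : ℝ) * z e.1.2) ^ 2 ≤ 128 * (N : ℝ) ^ 2 := by
  have h1 := two_mul_sum_edge_mul_le (f := fun v => (z v : ℝ) ^ 2) fun v => by positivity
  have h2 : (∑ v, (z v : ℝ) ^ 2) ^ 2 ≤ (16 * N) ^ 2 :=
    pow_le_pow_left₀ (Finset.sum_nonneg fun v _ => by positivity) hz 2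
  simp_rw [← mul_pow] at h1
  linarith

lemma light_sum_le {N : ℕ} {d : ℝ} (hd : 0 < d) {p : EdgeIdx N → ℝ} (hp0 : ∀ e, 0 ≤ p e)
    (hp : ∀ e, p e ≤ 2 * d / N) {ω : Config N} {k : Fin N → ℝ} {z : Fin N → ℕ}
    (hk : ∀ v, |k v| = z v) (hz : ∑ v, (z v : ℝ) ^ 2 ≤ 16 * N) {σ : ℝ} (hσ : |σ| = 1)
    (h : edgeExponent p (lightExponent d σ k) ω ≤ ∑ v, (z v : ℝ) + 3 * N) :
    σ * ∑ e : EdgeIdx N, (if |k e.1.1 * k e.1.2| ≤ √d then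
      k e.1.1 * k e.1.2 * (edgeInd ω e - p e) else 0) ≤ 275 * (√d * N) := by
  have hs : 0 < √d := Real.sqrt_pos.2 hd
  have hN : (0 : ℝ) ≤ N := Nat.cast_nonneg N
  have hrem : ∑ e, p e * (Real.exp (lightExponent d σ k e) - 1 - lightExponent d σ k e) ≤
      256 * N := by
    have h1 : ∀ e : EdgeIdx N,
        p e * (Real.exp (lightExponent d σ k e) - 1 - lightExponent d σ k e) ≤
        2 / N * ((z e.1.1 : ℝ) * z e.1.2) ^ 2 := by
      intro e
      unfold lightExponent
      split_ifs with hl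
      · set t := σ * (k e.1.1 * k e.1.2) / √d with ht
        have habs : |t| = |k e.1.1 * k e.1.2| / √d := by
          rw [ht, abs_div, abs_mul, hσ, one_mul, abs_of_pos hs]
        have h2 := (abs_le.1 (Real.abs_exp_sub_one_sub_id_le
          (by rw [habs, div_le_one hs]; exact hl : |t| ≤ 1))).2
        have h3 : t ^ 2 = ((z e.1.1 : ℝ) * z e.1.2) ^ 2 / d := by
          rw [← sq_abs t, habs, abs_mul, hk, hk, div_pow, Real.sq_sqrt hd.le]
        rw [h3] at h2
        calc _ ≤ p e * (((z e.1.1 : ℝ) * z e.1.2) ^ 2 / d) := by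
              gcongr; exact hp0 e
          _ ≤ 2 * d / N * (((z e.1.1 : ℝ) * z e.1.2) ^ 2 / d) := by gcongr; exact hp e
          _ = _ := by field_simp
      · simp; positivity
    refine (Finset.sum_le_sum fun e _ => h1 e).trans ?_
    rw [← Finset.mul_sum]
    calc _ ≤ 2 / N * (128 * (N : ℝ) ^ 2) := by gcongr; exact sum_edge_sq_mul_sq_le hz
      _ ≤ 256 * N := by
        rcases hN.eq_or_lt with h0 | h0
        · rw [← h0]; simp
        · apply le_of_eq; field_simp; ring
  have hlin : ∑ v, (z v : ℝ) ≤ 16 * N := by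
    refine (Finset.sum_le_sum fun v _ => ?_).trans hz
    have : z v ≤ z v ^ 2 := Nat.le_self_pow two_ne_zero _
    exact_mod_cast this
  have hid : σ * ∑ e : EdgeIdx N, (if |k e.1.1 * k e.1.2| ≤ √d then
      k e.1.1 * k e.1.2 * (edgeInd ω e - p e) else 0) =
      √d * (edgeExponent p (lightExponent d σ k) ω +
        ∑ e, p e * (Real.exp (lightExponent d σ k e) - 1 - lightExponent d σ k e)) := by
    rw [edgeExponent, ← Finset.sum_add_distrib, Finset.mul_sum, Finset.mul_sum]
    refine Finset.sum_congr rfl fun e _ => ?_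
    unfold lightExponent
    split_ifs
    · field_simp; ring
    · simp
  rw [hid]
  calc _ ≤ √d * ((16 * N + 3 * N) + 256 * N) := by gcongr; linarith
    _ = _ := by ring

/-- Deterministic bound for the centered quadratic form of an integral vector. -/
lemma abs_sum_edge_le {N : ℕ} (hN0 : 0 < N) {d : ℝ} (hd : 0 < d)
    {p : EdgeIdx N → ℝ} (hp0 : ∀ e, 0 ≤ p e)
    (hp : ∀ e, p e ≤ 2 * d / N) {ω : Config N} {k : Fin N → ℝ} {z : Fin N → ℕ}
    (hk : ∀ v, |k v| = z v) (hz : ∑ v, (z v : ℝ) ^ 2 ≤ 16 * N)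
    (hdeg : ∀ v, z v ≠ 0 → (degOf ω v : ℝ) ≤ 20 * d)
    (hlight : ∀ σ : ℝ, |σ| = 1 →
      edgeExponent p (lightExponent d σ k) ω ≤ ∑ v, (z v : ℝ) + 3 * N)
    (hlev : ∀ j ∈ Finset.Icc 1 (Nat.log 4 (64 * N)),
      edgeExponent p (levelExponent d (fun v => (z v).size) j) ω ≤
        ∑ v, (if j ≤ (z v).size then 3 * ((z v).size : ℝ) else 0) + 2 * N / 16 ^ j +
          Nat.log 4 (64 * N)) :
    |∑ e : EdgeIdx N, k e.1.1 * k e.1.2 * (edgeInd ω e - p e)| ≤ 16000 * (√d * N) := by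
  have hs : 0 < √d := Real.sqrt_pos.2 hd
  have hN : (0 : ℝ) ≤ N := Nat.cast_nonneg N
  have hsize : ∀ v, (z v).size ≠ 0 → z v ≠ 0 := fun v h h0 => h (by simp [h0])
  have hL : ∀ v, (z v).size ≤ Nat.log 4 (64 * N) := by
    intro v
    by_cases h0 : z v = 0
    · simp [h0]
    · have h1 : (z v : ℝ) ^ 2 ≤ 16 * N :=
        (Finset.single_le_sum (fun w _ => by positivity : ∀ w ∈ Finset.univ,
          0 ≤ (z w : ℝ) ^ 2) (Finset.mem_univ v)).trans hz
      have h2 : z v ^ 2 ≤ 16 * N := by exact_mod_cast h1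
      exact Nat.le_log_of_pow_le (by norm_num) ((four_pow_size_le h0).trans (by omega))
  have hM : (4 : ℝ) ^ Nat.log 4 (64 * N) ≤ 64 * N := by
    exact_mod_cast Nat.pow_log_le_self 4 (by omega : 64 * N ≠ 0)
  have hsum : ∑ v, levelSq (fun v => (z v).size) v ≤ 64 * N := by
    refine (Finset.sum_le_sum fun v _ => levelSq_size_le z v).trans ?_
    rw [← Finset.mul_sum]; linarith
  have hheavy := heavy_sum_le hd hp hL hM (fun v h => hdeg v (hsize v h)) hsum hlev
  set light := ∑ e : EdgeIdx N, (if |k e.1.1 * k e.1.2| ≤ √d then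
      k e.1.1 * k e.1.2 * (edgeInd ω e - p e) else 0) with hlightdef
  have hl : |light| ≤ 275 * (√d * N) := by
    have h1 := light_sum_le hd hp0 hp hk hz (σ := 1) (by simp) (hlight 1 (by simp))
    have h2 := light_sum_le hd hp0 hp hk hz (σ := -1) (by simp) (hlight (-1) (by simp))
    rw [← hlightdef] at h1 h2
    exact abs_le.2 ⟨by linarith, by linarith⟩
  have hterm : ∀ e : EdgeIdx N, |(if |k e.1.1 * k e.1.2| ≤ √d then 0 else
      k e.1.1 * k e.1.2 * (edgeInd ω e - p e))| ≤
      (if (z e.1.1).size ≠ 0 ∧ (z e.1.2).size ≠ 0 ∧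
        √d ≤ levelProd (fun v => (z v).size) e then
        levelProd (fun v => (z v).size) e * edgeInd ω e else 0) +
      2 * √d / N * ((z e.1.1 : ℝ) * z e.1.2) ^ 2 := by
    intro e
    have hX := edgeInd_nonneg ω e
    have hQ : 0 < levelProd (fun v => (z v).size) e := by unfold levelProd; positivity
    split_ifs with h1 h2 h2
    · rw [abs_zero]; positivity
    · rw [abs_zero]; positivity
    · have hzz : (z e.1.1 : ℝ) * z e.1.2 ≤ levelProd (fun v => (z v).size) e := by
        unfold levelProd
        rw [pow_add]
        have a1 : (z e.1.1 : ℝ) ≤ 2 ^ (z e.1.1).size := by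
          exact_mod_cast (Nat.lt_size_self _).le
        have a2 : (z e.1.2 : ℝ) ≤ 2 ^ (z e.1.2).size := by
          exact_mod_cast (Nat.lt_size_self _).le
        gcongr
      have habs : |k e.1.1 * k e.1.2| = (z e.1.1 : ℝ) * z e.1.2 := by rw [abs_mul, hk, hk]
      rw [habs, not_le] at h1
      rw [abs_mul, habs]
      have b1 : |edgeInd ω e - p e| ≤ edgeInd ω e + p e := by
        refine (abs_sub _ _).trans ?_
        rw [abs_of_nonneg hX, abs_of_nonneg (hp0 e)]
      have b2 : (z e.1.1 : ℝ) * z e.1.2 * p e ≤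
          2 * √d / N * ((z e.1.1 : ℝ) * z e.1.2) ^ 2 := by
        have c1 : √d * ((z e.1.1 : ℝ) * z e.1.2) ≤ ((z e.1.1 : ℝ) * z e.1.2) ^ 2 := by
          rw [sq]; gcongr
        calc _ ≤ (z e.1.1 : ℝ) * z e.1.2 * (2 * d / N) := by gcongr; exact hp e
          _ = 2 * √d / N * (√d * ((z e.1.1 : ℝ) * z e.1.2)) := by
            nth_rewrite 1 [← Real.mul_self_sqrt hd.le]; ring
          _ ≤ _ := by gcongr
      calc _ ≤ (z e.1.1 : ℝ) * z e.1.2 * (edgeInd ω e + p e) := by gcongr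
        _ = (z e.1.1 : ℝ) * z e.1.2 * edgeInd ω e + (z e.1.1 : ℝ) * z e.1.2 * p e := by ring
        _ ≤ _ := by gcongr
    · exfalso
      have habs : |k e.1.1 * k e.1.2| = (z e.1.1 : ℝ) * z e.1.2 := by rw [abs_mul, hk, hk]
      rw [habs, not_le] at h1
      have h3 : 0 < (z e.1.1 : ℝ) * z e.1.2 := hs.trans h1
      have n1 : z e.1.1 ≠ 0 := fun h0 => by simp [h0] at h3
      have n2 : z e.1.2 ≠ 0 := fun h0 => by simp [h0] at h3
      refine h2 ⟨(Nat.size_pos.2 (Nat.pos_of_ne_zero n1)).ne',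
        (Nat.size_pos.2 (Nat.pos_of_ne_zero n2)).ne', h1.le.trans ?_⟩
      unfold levelProd
      rw [pow_add]
      have a1 : (z e.1.1 : ℝ) ≤ 2 ^ (z e.1.1).size := by
        exact_mod_cast (Nat.lt_size_self _).le
      have a2 : (z e.1.2 : ℝ) ≤ 2 ^ (z e.1.2).size := by
        exact_mod_cast (Nat.lt_size_self _).le
      gcongr
  have hsplit : ∑ e : EdgeIdx N, k e.1.1 * k e.1.2 * (edgeInd ω e - p e) = light +
      ∑ e : EdgeIdx N, (if |k e.1.1 * k e.1.2| ≤ √d then 0 else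
        k e.1.1 * k e.1.2 * (edgeInd ω e - p e)) := by
    rw [hlightdef, ← Finset.sum_add_distrib]
    exact Finset.sum_congr rfl fun e _ => by split_ifs <;> simp
  have hH := (Finset.abs_sum_le_sum_abs (fun e : EdgeIdx N => if |k e.1.1 * k e.1.2| ≤ √d then 0
    else k e.1.1 * k e.1.2 * (edgeInd ω e - p e)) Finset.univ).trans
      (Finset.sum_le_sum fun e _ => hterm e)
  rw [Finset.sum_add_distrib, ← Finset.mul_sum] at hH
  have hm : 2 * √d / N * ∑ e : EdgeIdx N, ((z e.1.1 : ℝ) * z e.1.2) ^ 2 ≤ 256 * (√d * N) := by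
    calc _ ≤ 2 * √d / N * (128 * (N : ℝ) ^ 2) := by gcongr; exact sum_edge_sq_mul_sq_le hz
      _ ≤ 256 * (√d * N) := by
        rcases hN.eq_or_lt with h0 | h0
        · rw [← h0]; simp
        · apply le_of_eq; field_simp; ring
  rw [hsplit]
  refine (abs_add_le _ _).trans ?_
  have : 0 ≤ √d * N := by positivity
  linarith

end QuadraticForm

section Probabilities

lemma exp_neg_add_sum_pi_le {N : ℕ} {α : Type*} [DecidableEq α] (F : Finset α) (w : α → ℝ)
    (q : ℝ) {r : ℝ} (hr : ∑ i ∈ F, Real.exp (-w i) ≤ Real.exp r) :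
    ∑ κ ∈ Fintype.piFinset fun _ : Fin N => F, Real.exp (-(∑ v, w (κ v) + q)) ≤
      Real.exp (N * r - q) := by
  have h1 : ∀ κ : Fin N → α, Real.exp (-(∑ v, w (κ v) + q)) =
      Real.exp (-q) * ∏ v, Real.exp (-w (κ v)) := fun κ => by
    rw [← Real.exp_sum, ← Real.exp_add, Finset.sum_neg_distrib]; ring_nf
  simp_rw [h1]
  rw [← Finset.mul_sum, Finset.sum_prod_piFinset F fun _ i => Real.exp (-w i)]
  rw [Finset.prod_const, Finset.card_univ, Fintype.card_fin]
  have h2 := pow_le_pow_left₀ (Finset.sum_nonneg fun i _ => (Real.exp_pos (-w i)).le) hr N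
  rw [← Real.exp_nat_mul] at h2
  calc _ ≤ Real.exp (-q) * Real.exp (N * r) := by gcongr
    _ = _ := by rw [← Real.exp_add]; ring_nf

/-- Exponent counting the degrees of the vertices of `S`. -/
noncomputable def degreeExponent {N : ℕ} (S : Finset (Fin N)) (e : EdgeIdx N) : ℝ :=
  ((if e.1.1 ∈ S then 1 / 2 else 0) + if e.1.2 ∈ S then 1 / 2 else 0)

lemma measureReal_degreeExponent_le {N : ℕ} {p : EdgeIdx N → ℝ} (hp0 : ∀ e, 0 ≤ p e)
    (hp1 : ∀ e, p e ≤ 1) :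
    (Measure.pi fun e => bern (p e)).real
      {ω | ∃ S : Finset (Fin N), 2 * N < edgeExponent p (degreeExponent S) ω} ≤
      Real.exp (-N) := by
  have h := measureReal_exists_lt_edgeExponent_le hp0 hp1 (Finset.univ : Finset (Finset (Fin N)))
    degreeExponent fun _ => 2 * (N : ℝ)
  simp only [Finset.mem_univ, true_and] at h
  refine h.trans ?_
  rw [Finset.sum_const, Finset.card_univ, Fintype.card_finset, Fintype.card_fin, nsmul_eq_mul]
  have h1 : (2 : ℝ) ^ N ≤ Real.exp N := by
    have := pow_le_pow_left₀ (by norm_num) (by linarith [Real.add_one_le_exp 1] :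
      (2 : ℝ) ≤ Real.exp 1) N
    rwa [← Real.exp_nat_mul, mul_one] at this
  push_cast
  calc _ ≤ Real.exp N * Real.exp (-(2 * N)) := by gcongr
    _ = _ := by rw [← Real.exp_add]; ring_nf

lemma sum_exp_neg_abs_le (R : ℕ) :
    ∑ i ∈ Finset.Icc (-(R : ℤ)) R, Real.exp (-(i.natAbs : ℝ)) ≤ Real.exp 2 := by
  have key : ∑ i ∈ Finset.Icc (-(R : ℤ)) R, Real.exp (-(i.natAbs : ℝ)) ≤ 3 - 2 * (1 / 2) ^ R := by
    induction R with
    | zero => norm_num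
    | succ R ih =>
      have hset : Finset.Icc (-((R + 1 : ℕ) : ℤ)) ((R + 1 : ℕ) : ℤ) =
          insert ((R + 1 : ℕ) : ℤ) (insert (-((R + 1 : ℕ) : ℤ)) (Finset.Icc (-(R : ℤ)) R)) := by
        ext x; simp only [Finset.mem_Icc, Finset.mem_insert]; omega
      rw [hset, Finset.sum_insert (by simp only [Finset.mem_Icc, Finset.mem_insert]; omega),
        Finset.sum_insert (by simp only [Finset.mem_Icc]; omega), Int.natAbs_neg,
        Int.natAbs_natCast]
      have h1 : Real.exp (-((R + 1 : ℕ) : ℝ)) ≤ (1 / 2) ^ (R + 1) := by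
        have h2 : Real.exp (-1) ≤ 1 / 2 := by
          rw [Real.exp_neg, one_div]
          exact inv_anti₀ (by norm_num) (by linarith [Real.add_one_le_exp 1])
        have := pow_le_pow_left₀ (Real.exp_pos _).le h2 (R + 1)
        rwa [← Real.exp_nat_mul, mul_neg_one] at this
      rw [pow_succ] at h1 ⊢
      linarith
  have h2 := Real.add_one_le_exp 2
  have h3 : (0 : ℝ) < (1 / 2) ^ R := by positivity
  linarith

lemma measureReal_lightExponent_le {N : ℕ} {p : EdgeIdx N → ℝ} (hp0 : ∀ e, 0 ≤ p e)
    (hp1 : ∀ e, p e ≤ 1) (d σ : ℝ) (R : ℕ) :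
    (Measure.pi fun e => bern (p e)).real
      {ω | ∃ κ : Fin N → ℤ, (∀ v, (κ v).natAbs ≤ R) ∧ ∑ v, ((κ v).natAbs : ℝ) + 3 * N <
        edgeExponent p (lightExponent d σ fun v => (κ v : ℝ)) ω} ≤ Real.exp (-N) := by
  have h := measureReal_exists_lt_edgeExponent_le hp0 hp1
    (Fintype.piFinset fun _ : Fin N => Finset.Icc (-(R : ℤ)) R)
    (fun κ => lightExponent d σ fun v => (κ v : ℝ))
    fun κ => ∑ v, ((κ v).natAbs : ℝ) + 3 * N
  refine le_trans (measureReal_mono ?_) (h.trans ?_)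
  · rintro ω ⟨κ, hκ, hlt⟩
    refine ⟨κ, Fintype.mem_piFinset.2 fun v => ?_, hlt⟩
    have := hκ v
    simp only [Finset.mem_Icc]
    omega
  · refine (exp_neg_add_sum_pi_le _ (fun i : ℤ => (i.natAbs : ℝ)) (3 * (N : ℝ))
      (sum_exp_neg_abs_le R)).trans ?_
    apply le_of_eq; ring_nf

lemma sum_exp_neg_three_mul_le (j M : ℕ) :
    ∑ i ∈ Finset.Icc j M, Real.exp (-(3 * (i : ℝ))) ≤ 2 / 16 ^ j := by
  have h0 : ∀ i : ℕ, Real.exp (-(3 * (i : ℝ))) ≤ (1 / 16) ^ i := fun i => by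
    have h2 : Real.exp (-3) ≤ 1 / 16 := by
      rw [Real.exp_neg, one_div]
      refine inv_anti₀ (by norm_num) ?_
      have h3 : (2.7 : ℝ) ^ 3 ≤ Real.exp 1 ^ 3 :=
        pow_le_pow_left₀ (by norm_num) (by linarith [Real.exp_one_gt_d9]) 3
      rw [← Real.exp_nat_mul] at h3
      norm_num at h3
      linarith
    have := pow_le_pow_left₀ (Real.exp_pos _).le h2 i
    rw [← Real.exp_nat_mul] at this
    rwa [show -(3 * (i : ℝ)) = i * -3 by ring]
  refine (Finset.sum_le_sum fun i _ => h0 i).trans ?_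
  rw [← Finset.Ico_succ_right_eq_Icc]
  rcases le_or_gt j (M + 1) with h | h
  · have h1 := geom_sum_Ico' (x := (1 / 16 : ℝ)) (by norm_num) h
    rw [Nat.succ_eq_succ, Nat.succ_eq_add_one, h1]
    have h2 : (0 : ℝ) < (1 / 16) ^ (M + 1) := by positivity
    have h3 : (0 : ℝ) < (1 / 16) ^ j := by positivity
    have h4 : (2 : ℝ) / 16 ^ j = 2 * (1 / 16) ^ j := by rw [one_div, inv_pow]; rfl
    rw [h4, div_le_iff₀ (by norm_num)]
    linarith
  · rw [Finset.Ico_eq_empty (by simpa using h.le), Finset.sum_empty]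
    positivity

lemma measureReal_levelExponent_le {N : ℕ} {p : EdgeIdx N → ℝ} (hp0 : ∀ e, 0 ≤ p e)
    (hp1 : ∀ e, p e ≤ 1) (d : ℝ) (M : ℕ) {j : ℕ} (hj : 1 ≤ j) :
    (Measure.pi fun e => bern (p e)).real
      {ω | ∃ L : Fin N → ℕ, (∀ v, L v ≤ M) ∧
        ∑ v, (if j ≤ L v then 3 * (L v : ℝ) else 0) + 2 * N / 16 ^ j + M <
        edgeExponent p (levelExponent d L j) ω} ≤ Real.exp (-M) := by
  have h := measureReal_exists_lt_edgeExponent_le hp0 hp1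
    (Fintype.piFinset fun _ : Fin N => insert 0 (Finset.Icc j M))
    (fun L => levelExponent d L j)
    fun L => ∑ v, (if j ≤ L v then 3 * (L v : ℝ) else 0) + (2 * N / 16 ^ j + M)
  refine le_trans (measureReal_mono ?_) (h.trans ?_)
  · rintro ω ⟨L, hL, hlt⟩
    let L' : Fin N → ℕ := fun v => if j ≤ L v then L v else 0
    have h1 : levelExponent d L' j = levelExponent d L j := by
      funext e
      by_cases hm : j ≤ L e.1.1 ∧ j ≤ L e.1.2
      · have h2 : L' e.1.1 = L e.1.1 := if_pos hm.1
        have h3 : L' e.1.2 = L e.1.2 := if_pos hm.2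
        rw [levelExponent, levelExponent, levelProd, levelProd, h2, h3]
      · have h2 : ¬ min (L e.1.1) (L e.1.2) = j := by omega
        have h3 : ¬ min (L' e.1.1) (L' e.1.2) = j := by
          simp only [L']; split_ifs <;> omega
        simp only [levelExponent, if_neg fun hh : _ ∧ _ => h2 hh.1,
          if_neg fun hh : _ ∧ _ => h3 hh.1]
    have h2 : ∀ v, (if j ≤ L' v then 3 * (L' v : ℝ) else 0) =
        if j ≤ L v then 3 * (L v : ℝ) else 0 := fun v => by
      simp only [L']
      by_cases hv : j ≤ L v
      · simp [hv]
      · simp [hv]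
    refine ⟨L', Fintype.mem_piFinset.2 fun v => ?_, ?_⟩
    · have := hL v
      simp only [L', Finset.mem_insert, Finset.mem_Icc]
      split_ifs <;> omega
    · simp only [h1, h2]
      linarith
  · have hr : ∑ i ∈ insert 0 (Finset.Icc j M), Real.exp (-(if j ≤ i then 3 * (i : ℝ) else 0)) ≤
        Real.exp (2 / 16 ^ j) := by
      rw [Finset.sum_insert (by simp; omega), if_neg (by omega), neg_zero, Real.exp_zero]
      have h1 : ∑ i ∈ Finset.Icc j M, Real.exp (-(if j ≤ i then 3 * (i : ℝ) else 0)) =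
          ∑ i ∈ Finset.Icc j M, Real.exp (-(3 * (i : ℝ))) :=
        Finset.sum_congr rfl fun i hi => by rw [if_pos (Finset.mem_Icc.1 hi).1]
      rw [h1]
      linarith [sum_exp_neg_three_mul_le j M, Real.add_one_le_exp ((2 : ℝ) / 16 ^ j)]
    refine (exp_neg_add_sum_pi_le _ (fun i : ℕ => if j ≤ i then 3 * (i : ℝ) else 0)
      (2 * (N : ℝ) / 16 ^ j + M) hr).trans ?_
    apply le_of_eq; ring_nf

end Probabilities

section Typical

/-- Configurations avoiding every large deviation event used for the spectral norm bound. -/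
structure IsTypical {N : ℕ} (p : EdgeIdx N → ℝ) (d : ℝ) (ω : Config N) : Prop where
  degree : ∀ S : Finset (Fin N), edgeExponent p (degreeExponent S) ω ≤ 2 * N
  light : ∀ σ : ℝ, |σ| = 1 → ∀ κ : Fin N → ℤ, (∀ v, (κ v).natAbs ≤ 16 * N) →
    edgeExponent p (lightExponent d σ fun v => (κ v : ℝ)) ω ≤
      ∑ v, ((κ v).natAbs : ℝ) + 3 * N
  level : ∀ j ∈ Finset.Icc 1 (Nat.log 4 (64 * N)), ∀ L : Fin N → ℕ,
    (∀ v, L v ≤ Nat.log 4 (64 * N)) → edgeExponent p (levelExponent d L j) ω ≤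
      ∑ v, (if j ≤ L v then 3 * (L v : ℝ) else 0) + 2 * N / 16 ^ j + Nat.log 4 (64 * N)

lemma measureReal_not_isTypical_le {N : ℕ} {p : EdgeIdx N → ℝ} (hp0 : ∀ e, 0 ≤ p e)
    (hp1 : ∀ e, p e ≤ 1) (d : ℝ) :
    (Measure.pi fun e => bern (p e)).real {ω | ¬ IsTypical p d ω} ≤
      3 * Real.exp (-N) + Nat.log 4 (64 * N) * Real.exp (-(Nat.log 4 (64 * N) : ℕ)) := by
  set μ : Measure (Config N) := Measure.pi fun e => bern (p e) with hμ
  set M := Nat.log 4 (64 * N) with hM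
  set D : Set (Config N) :=
    {ω | ∃ S : Finset (Fin N), 2 * N < edgeExponent p (degreeExponent S) ω} with hD
  set B : ℝ → Set (Config N) := fun σ =>
    {ω | ∃ κ : Fin N → ℤ, (∀ v, (κ v).natAbs ≤ 16 * N) ∧ ∑ v, ((κ v).natAbs : ℝ) + 3 * N <
        edgeExponent p (lightExponent d σ fun v => (κ v : ℝ)) ω} with hB
  set C : ℕ → Set (Config N) := fun j => {ω | ∃ L : Fin N → ℕ, (∀ v, L v ≤ M) ∧
        ∑ v, (if j ≤ L v then 3 * (L v : ℝ) else 0) + 2 * N / 16 ^ j + M <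
        edgeExponent p (levelExponent d L j) ω} with hC
  have hsub : {ω | ¬ IsTypical p d ω} ⊆
      ((D ∪ B 1) ∪ B (-1)) ∪ ⋃ j ∈ Finset.Icc 1 M, C j := by
    intro ω hω
    by_contra hcon
    simp only [Set.mem_union, Set.mem_iUnion, not_or, not_exists, hD, hB, hC, Set.mem_ofPred_eq,
      not_and, not_lt] at hcon
    obtain ⟨⟨⟨h1, h2⟩, h3⟩, h4⟩ := hcon
    refine hω ⟨h1, fun σ hσ => ?_, h4⟩
    rcases (abs_eq zero_le_one).1 hσ with rfl | rfl
    · exact h2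
    · exact h3
  have h1 : μ.real D ≤ Real.exp (-N) := measureReal_degreeExponent_le hp0 hp1
  have h2 : ∀ σ, μ.real (B σ) ≤ Real.exp (-N) := fun σ =>
    measureReal_lightExponent_le hp0 hp1 d σ _
  have h3 : μ.real (⋃ j ∈ Finset.Icc 1 M, C j) ≤ M * Real.exp (-M) := by
    refine (measureReal_biUnion_finset_le _ _).trans ?_
    refine (Finset.sum_le_sum fun j hj =>
      measureReal_levelExponent_le hp0 hp1 d M (Finset.mem_Icc.1 hj).1).trans ?_
    simp
  have h4 := measureReal_union_le (μ := μ) D (B 1)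
  have h5 := measureReal_union_le (μ := μ) (D ∪ B 1) (B (-1))
  have h6 := measureReal_union_le (μ := μ) ((D ∪ B 1) ∪ B (-1)) (⋃ j ∈ Finset.Icc 1 M, C j)
  have h7 : μ.real {ω | ¬ IsTypical p d ω} ≤ _ := measureReal_mono hsub
  linarith [h2 1, h2 (-1)]

lemma IsTypical.card_high_degree_le {N : ℕ} (hN : 0 < N) {p : EdgeIdx N → ℝ} {d : ℝ} (hd : 0 < d)
    (hp0 : ∀ e, 0 ≤ p e) (hp : ∀ e, p e ≤ 2 * d / N) {ω : Config N} (h : IsTypical p d ω) :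
    4 * d * ((univ.filter fun v => 20 * d < (degOf ω v : ℝ)).card : ℝ) ≤ N := by
  set T := univ.filter fun v => 20 * d < (degOf ω v : ℝ) with hT
  have hN' : (0 : ℝ) < N := by exact_mod_cast hN
  let f : Fin N → ℝ := fun v => if v ∈ T then 1 / 2 else 0
  have hf : ∀ v, 0 ≤ f v := fun v => by simp only [f]; split_ifs <;> norm_num
  have hf1 : ∀ v, f v ≤ 1 / 2 := fun v => by simp only [f]; split_ifs <;> norm_num
  have hsum : ∑ v, f v = T.card / 2 := by
    simp [f, Finset.sum_ite_mem, div_eq_mul_inv]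
  have h1 : 10 * d * T.card ≤ ∑ e, degreeExponent T e * edgeInd ω e := by
    have h2 : ∑ e, degreeExponent T e * edgeInd ω e = ∑ v, f v * degOf ω v :=
      sum_edge_add_mul_edgeInd ω f
    rw [h2]
    calc 10 * d * T.card = ∑ v, f v * (20 * d) := by rw [← Finset.sum_mul, hsum]; ring
      _ ≤ _ := Finset.sum_le_sum fun v _ => by
        by_cases hv : v ∈ T
        · exact mul_le_mul_of_nonneg_left (by rw [hT, Finset.mem_filter] at hv; exact hv.2.le)
            (hf v)
        · simp [f, hv]
  have h2 : ∑ e, p e * (Real.exp (degreeExponent T e) - 1) ≤ 2 * d * T.card := by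
    have h3 : ∀ e : EdgeIdx N, p e * (Real.exp (degreeExponent T e) - 1) ≤
        4 * d / N * (f e.1.1 + f e.1.2) := fun e => by
      have h4 : degreeExponent T e = f e.1.1 + f e.1.2 := rfl
      have a1 := hf e.1.1
      have a2 := hf e.1.2
      have a3 := hf1 e.1.1
      have a4 := hf1 e.1.2
      rw [h4]
      set t := f e.1.1 + f e.1.2
      have h5 := (abs_le.1 (Real.abs_exp_sub_one_sub_id_le
          (by rw [abs_of_nonneg (by linarith)]; linarith : |t| ≤ 1))).2
      have h6 : Real.exp t - 1 ≤ 2 * t := by nlinarith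
      calc _ ≤ p e * (2 * t) := by gcongr; exact hp0 e
        _ ≤ 2 * d / N * (2 * t) := by
          have : 0 ≤ 2 * t := by linarith
          gcongr
          exact hp e
        _ = _ := by ring
    refine (Finset.sum_le_sum fun e _ => h3 e).trans ?_
    rw [← Finset.mul_sum]
    calc _ ≤ 4 * d / N * (N * ∑ v, f v) := by gcongr; exact sum_edge_add_le hf
      _ = _ := by rw [hsum]; field_simp; ring
  have h3 := h.degree T
  rw [edgeExponent, Finset.sum_sub_distrib] at h3
  linarith

/-- Centered adjacency matrix with the rows and columns of high degree vertices removed. -/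
noncomputable def trimmedCentered {N : ℕ} (d : ℝ) (P : Matrix (Fin N) (Fin N) ℝ) (ω : Config N) :
    Matrix (Fin N) (Fin N) ℝ :=
  zeroOutHighDeg d ω (adjMat ω - P)

lemma IsTypical.abs_trimmedCentered_le {N : ℕ} (hN : 0 < N) {P : Matrix (Fin N) (Fin N) ℝ} {d : ℝ}
    (hd : 0 < d) (hP0 : ∀ i, P i i = 0) (hPs : ∀ i j, P i j = P j i) (hPn : ∀ i j, 0 ≤ P i j)
    (hP : ∀ i j, P i j ≤ 2 * d / N) {ω : Config N}
    (h : IsTypical (fun e => P e.1.1 e.1.2) d ω) (κ : Fin N → ℤ)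
    (hκ : ∑ v, (κ v : ℝ) ^ 2 ≤ 16 * N) :
    |∑ i, ∑ j, trimmedCentered d P ω i j * κ i * κ j| ≤ 32000 * (√d * N) := by
  let κ' : Fin N → ℤ := fun v => if 20 * d < (degOf ω v : ℝ) then 0 else κ v
  have hz : ∑ v, ((κ' v).natAbs : ℝ) ^ 2 ≤ 16 * N := by
    refine (Finset.sum_le_sum fun v _ => ?_).trans hκ
    rw [Nat.cast_natAbs, Int.cast_abs, sq_abs]
    simp only [κ']
    split_ifs
    · simp; positivity
    · exact le_rfl
  have hz' : ∀ v, (κ' v).natAbs ≤ 16 * N ∧ (κ' v).natAbs.size ≤ Nat.log 4 (64 * N) := fun v => by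
    have h1 : ((κ' v).natAbs : ℝ) ^ 2 ≤ 16 * N :=
      (Finset.single_le_sum (fun w _ => by positivity : ∀ w ∈ Finset.univ,
        0 ≤ ((κ' w).natAbs : ℝ) ^ 2) (Finset.mem_univ v)).trans hz
    have h2 : (κ' v).natAbs ^ 2 ≤ 16 * N := by exact_mod_cast h1
    refine ⟨(Nat.le_self_pow two_ne_zero _).trans h2, ?_⟩
    by_cases h0 : (κ' v).natAbs = 0
    · simp [h0]
    · exact Nat.le_log_of_pow_le (by norm_num) ((four_pow_size_le h0).trans (by omega))
  have key := abs_sum_edge_le hN hd (fun e => hPn e.1.1 e.1.2) (fun e => hP e.1.1 e.1.2)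
    (ω := ω) (k := fun v => (κ' v : ℝ)) (z := fun v => (κ' v).natAbs)
    (fun v => by rw [Nat.cast_natAbs, Int.cast_abs]) hz
    (fun v hv => by
      by_contra hcon
      exact hv (by simp [κ', not_le.1 hcon]))
    (fun σ hσ => h.light σ hσ κ' fun v => (hz' v).1)
    (fun j hj => h.level j hj (fun v => (κ' v).natAbs.size) fun v => (hz' v).2)
  have hs : ∑ i, ∑ j, trimmedCentered d P ω i j * κ i * κ j =
      2 * ∑ e : EdgeIdx N, (κ' e.1.1 : ℝ) * κ' e.1.2 * (edgeInd ω e - P e.1.1 e.1.2) := by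
    rw [sum_sum_eq_sum_edge _ fun i => by
      simp [trimmedCentered, zeroOutHighDeg, adjMat_self, hP0], Finset.mul_sum]
    refine Finset.sum_congr rfl fun e _ => ?_
    simp only [trimmedCentered, zeroOutHighDeg, Matrix.sub_apply, adjMat_comm ω e.1.2 e.1.1,
      hPs e.1.2 e.1.1, adjMat_edge, κ']
    by_cases h1 : 20 * d < (degOf ω e.1.1 : ℝ)
    · simp [h1]
    · by_cases h2 : 20 * d < (degOf ω e.1.2 : ℝ)
      · simp [h2]
      · simp only [h1, h2, or_self, if_false]; ring
  rw [hs, abs_mul, abs_two]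
  linarith

end Typical

section SpectralNorm

/-- A symmetric operator is controlled by its quadratic form on a `1/4`-net of the sphere. -/
lemma norm_le_of_forall_exists_approx {E : Type*} [NormedAddCommGroup E] [InnerProductSpace ℝ E]
    {T : E →L[ℝ] E} (hT : (T : E →ₗ[ℝ] E).IsSymmetric) {K : ℝ} (hK : 0 ≤ K)
    (h : ∀ x, ‖x‖ = 1 → ∃ y, ‖y‖ ≤ 1 ∧ ‖x - y‖ ≤ 1 / 4 ∧ |inner ℝ (T y) y| ≤ K) :
    ‖T‖ ≤ 2 * K := by
  have hunit : ∀ x : E, ‖x‖ = 1 → |inner ℝ (T x) x| ≤ K + ‖T‖ / 2 := by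
    intro x hx
    obtain ⟨y, hy, hxy, hq⟩ := h x hx
    have e : inner ℝ (T x) x = inner ℝ (T y) y + inner ℝ (T (x - y)) x +
        inner ℝ (T y) (x - y) := by
      rw [map_sub, inner_sub_left, inner_sub_right]; ring
    have h1 : |inner ℝ (T (x - y)) x| ≤ ‖T‖ * (1 / 4) := by
      refine (abs_real_inner_le_norm _ _).trans ?_
      rw [hx, mul_one]
      exact (T.le_opNorm _).trans (by gcongr)
    have h2 : |inner ℝ (T y) (x - y)| ≤ ‖T‖ * (1 / 4) := by
      refine (abs_real_inner_le_norm _ _).trans ?_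
      have : ‖T y‖ ≤ ‖T‖ := (T.le_opNorm y).trans (mul_le_of_le_one_right (norm_nonneg _) hy)
      gcongr
    rw [e]
    have h3 := abs_add_three (inner ℝ (T y) y) (inner ℝ (T (x - y)) x) (inner ℝ (T y) (x - y))
    linarith
  have hray : ∀ x : E, |T.rayleighQuotient x| ≤ K + ‖T‖ / 2 := by
    intro x
    by_cases hx : x = 0
    · subst hx
      simp only [ContinuousLinearMap.rayleighQuotient, norm_zero]
      simp; positivity
    · have hx' : ‖x‖ ≠ 0 := norm_ne_zero_iff.2 hx
      have h1 := hunit (‖x‖⁻¹ • x) (by rw [norm_smul, norm_inv, norm_norm, inv_mul_cancel₀ hx'])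
      rw [map_smul, real_inner_smul_left, real_inner_smul_right] at h1
      convert h1 using 2
      rw [ContinuousLinearMap.rayleighQuotient, ContinuousLinearMap.reApplyInnerSelf_apply]
      simp only [RCLike.re_to_real]
      field_simp
  have h2 : ‖T‖ ≤ K + ‖T‖ / 2 := by
    rw [T.norm_eq_iSup_rayleighQuotient hT]
    have : ⨆ x, |T.rayleighQuotient x| ≤ K + ‖T‖ / 2 := ciSup_le hray
    rwa [T.norm_eq_iSup_rayleighQuotient hT] at this
  linarith

lemma exists_int_abs_le_abs_sub_le (t : ℝ) : ∃ k : ℤ, |(k : ℝ)| ≤ |t| ∧ |t - k| ≤ 1 := by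
  rcases le_total 0 t with h | h
  · refine ⟨⌊t⌋, ?_, ?_⟩
    · rw [abs_of_nonneg h, abs_of_nonneg (by exact_mod_cast Int.floor_nonneg.2 h)]
      exact Int.floor_le t
    · rw [abs_of_nonneg (by linarith [Int.floor_le t])]
      linarith [Int.lt_floor_add_one t]
  · refine ⟨⌈t⌉, ?_, ?_⟩
    · rw [abs_of_nonpos h, abs_of_nonpos (by exact_mod_cast Int.ceil_le.2 (by simpa using h))]
      linarith [Int.le_ceil t]
    · rw [abs_of_nonpos (by linarith [Int.le_ceil t])]
      linarith [Int.ceil_lt_add_one t]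

lemma inner_toEuclideanLin_self {N : ℕ} (B : Matrix (Fin N) (Fin N) ℝ)
    (x : EuclideanSpace ℝ (Fin N)) :
    inner ℝ (Matrix.toEuclideanLin B x) x = ∑ i, ∑ j, B i j * x i * x j := by
  rw [PiLp.inner_apply]
  refine Finset.sum_congr rfl fun i _ => ?_
  simp only [RCLike.inner_apply, conj_trivial, Matrix.toLpLin_apply, Matrix.mulVec, dotProduct,
    Finset.mul_sum]
  exact Finset.sum_congr rfl fun j _ => by ring

lemma isSymmetric_toEuclideanLin {N : ℕ} {B : Matrix (Fin N) (Fin N) ℝ}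
    (hB : ∀ i j, B i j = B j i) : (Matrix.toEuclideanLin B).IsSymmetric := by
  rw [Matrix.isSymmetric_toEuclideanLin_iff]
  ext i j
  simp [hB i j]

/-- Spectral norm bound from the values of the quadratic form on integral vectors. -/
lemma norm_toEuclideanLin_le_of_int {N : ℕ} (hN : 0 < N) {B : Matrix (Fin N) (Fin N) ℝ}
    (hB : ∀ i j, B i j = B j i) {K : ℝ} (hK : 0 ≤ K)
    (h : ∀ κ : Fin N → ℤ, ∑ v, (κ v : ℝ) ^ 2 ≤ 16 * N →
      |∑ i, ∑ j, B i j * κ i * κ j| ≤ K * N) (x : EuclideanSpace ℝ (Fin N)) :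
    ‖Matrix.toEuclideanLin B x‖ ≤ K / 8 * ‖x‖ := by
  have hN' : (0 : ℝ) < N := by exact_mod_cast hN
  set T := LinearMap.toContinuousLinearMap (Matrix.toEuclideanLin B) with hT
  have hnorm : ‖T‖ ≤ 2 * (K / 16) := by
    refine norm_le_of_forall_exists_approx (isSymmetric_toEuclideanLin hB) (by positivity) ?_
    intro x hx
    have hx2 : ∑ v, x v ^ 2 = 1 := by
      rw [← EuclideanSpace.real_norm_sq_eq, hx, one_pow]
    set s : ℝ := 4 * √N with hs
    have hs0 : 0 < s := by positivity
    have hs2 : s ^ 2 = 16 * N := by rw [hs, mul_pow, Real.sq_sqrt hN'.le]; norm_num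
    choose κ hκ1 hκ2 using fun v => exists_int_abs_le_abs_sub_le (s * x v)
    have hκ : ∑ v, (κ v : ℝ) ^ 2 ≤ s ^ 2 := by
      calc _ ≤ ∑ v, (s * x v) ^ 2 := Finset.sum_le_sum fun v _ => sq_le_sq.2 (hκ1 v)
        _ = s ^ 2 := by simp_rw [mul_pow]; rw [← Finset.mul_sum, hx2, mul_one]
    refine ⟨WithLp.toLp 2 fun v => (κ v : ℝ) / s, ?_, ?_, ?_⟩
    · rw [← sq_le_one_iff₀ (norm_nonneg _), EuclideanSpace.real_norm_sq_eq]
      simp only [div_pow]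
      rw [← Finset.sum_div, div_le_one (by positivity)]
      exact hκ
    · rw [← sq_le_sq₀ (norm_nonneg _) (by norm_num), EuclideanSpace.real_norm_sq_eq]
      have h1 : ∀ v, (x v - (κ v : ℝ) / s) ^ 2 ≤ 1 / s ^ 2 := fun v => by
        have : x v - (κ v : ℝ) / s = (s * x v - κ v) / s := by field_simp
        rw [this, div_pow]
        gcongr
        exact (sq_le_one_iff_abs_le_one _).2 (hκ2 v)
      refine (Finset.sum_le_sum fun v _ => h1 v).trans ?_
      rw [Finset.sum_const, Finset.card_univ, Fintype.card_fin, nsmul_eq_mul, hs2]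
      apply le_of_eq; field_simp; norm_num
    · have h1 := h κ (hκ.trans hs2.le)
      have h2 : inner ℝ (T (WithLp.toLp 2 fun v => (κ v : ℝ) / s))
          (WithLp.toLp 2 fun v => (κ v : ℝ) / s) =
          (∑ i, ∑ j, B i j * κ i * κ j) / (16 * N) := by
        refine (inner_toEuclideanLin_self B _).trans ?_
        rw [← hs2, Finset.sum_div]
        refine Finset.sum_congr rfl fun i _ => ?_
        rw [Finset.sum_div]
        exact Finset.sum_congr rfl fun j _ => by field_simp
      rw [h2, abs_div, abs_of_pos (by positivity : (0 : ℝ) < 16 * N), div_le_iff₀ (by positivity)]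
      linarith
  refine (T.le_opNorm x).trans ?_
  gcongr
  linarith

/-- The spectral norm is at most the Frobenius norm. -/
lemma norm_toEuclideanLin_le_sqrt {N : ℕ} (B : Matrix (Fin N) (Fin N) ℝ)
    (x : EuclideanSpace ℝ (Fin N)) :
    ‖Matrix.toEuclideanLin B x‖ ≤ √(∑ i, ∑ j, B i j ^ 2) * ‖x‖ := by
  have h0 : 0 ≤ ∑ i, ∑ j, B i j ^ 2 :=
    Finset.sum_nonneg fun i _ => Finset.sum_nonneg fun j _ => sq_nonneg _
  rw [← sq_le_sq₀ (norm_nonneg _) (by positivity), mul_pow, Real.sq_sqrt h0,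
    EuclideanSpace.real_norm_sq_eq, EuclideanSpace.real_norm_sq_eq, Finset.sum_mul]
  refine Finset.sum_le_sum fun i _ => ?_
  simp only [Matrix.toLpLin_apply, Matrix.mulVec, dotProduct]
  exact Finset.sum_mul_sq_le_sq_mul_sq _ _ _

lemma zeroOutHighDeg_comm {N : ℕ} (d : ℝ) (ω : Config N) {B : Matrix (Fin N) (Fin N) ℝ}
    (hB : ∀ i j, B i j = B j i) (i j : Fin N) :
    zeroOutHighDeg d ω B i j = zeroOutHighDeg d ω B j i := by
  simp only [zeroOutHighDeg, hB i j, or_comm]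

/-- Removing few high degree vertices changes the mean matrix little. -/
lemma sum_sq_zeroOutHighDeg_sub_le {N : ℕ} (hN : 0 < N) {P : Matrix (Fin N) (Fin N) ℝ} {d : ℝ}
    (hd : 0 < d) (hPn : ∀ i j, 0 ≤ P i j) (hP : ∀ i j, P i j ≤ 2 * d / N) {ω : Config N}
    (hT : 4 * d * ((univ.filter fun v => 20 * d < (degOf ω v : ℝ)).card : ℝ) ≤ N) :
    ∑ i, ∑ j, (zeroOutHighDeg d ω P - P) i j ^ 2 ≤ 2 * d := by
  have hN' : (0 : ℝ) < N := by exact_mod_cast hN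
  set T := univ.filter fun v => 20 * d < (degOf ω v : ℝ) with hTdef
  have h1 : ∀ i j, (zeroOutHighDeg d ω P - P) i j ^ 2 ≤
      (if i ∈ T then (2 * d / N) ^ 2 else 0) + if j ∈ T then (2 * d / N) ^ 2 else 0 := by
    intro i j
    have h2 : P i j ^ 2 ≤ (2 * d / N) ^ 2 := pow_le_pow_left₀ (hPn i j) (hP i j) 2
    have h3 : (0 : ℝ) ≤ (2 * d / N) ^ 2 := by positivity
    simp only [Matrix.sub_apply, zeroOutHighDeg, hTdef, Finset.mem_filter, Finset.mem_univ,
      true_and]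
    by_cases hi : 20 * d < (degOf ω i : ℝ) <;> by_cases hj : 20 * d < (degOf ω j : ℝ) <;>
      simp only [hi, hj, or_self, or_true, or_false, if_true, if_false,
        zero_sub, neg_sq, sub_self] <;> linarith
  refine (Finset.sum_le_sum fun i _ => Finset.sum_le_sum fun j _ => h1 i j).trans ?_
  simp only [Finset.sum_add_distrib, Finset.sum_const, Finset.card_univ, Fintype.card_fin,
    nsmul_eq_mul, Finset.sum_ite_mem, Finset.univ_inter, ← Finset.mul_sum]
  calc _ = 2 * d / N * (4 * d * T.card) := by field_simp; ring
    _ ≤ 2 * d / N * N := by gcongr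
    _ = 2 * d := by field_simp

lemma IsTypical.norm_sub_le {N : ℕ} (hN : 0 < N) {P : Matrix (Fin N) (Fin N) ℝ} {d : ℝ}
    (hd : 0 < d) (hP0 : ∀ i, P i i = 0) (hPs : ∀ i j, P i j = P j i) (hPn : ∀ i j, 0 ≤ P i j)
    (hP : ∀ i j, P i j ≤ 2 * d / N) {ω : Config N}
    (h : IsTypical (fun e => P e.1.1 e.1.2) d ω) (x : EuclideanSpace ℝ (Fin N)) :
    ‖Matrix.toEuclideanLin (zeroOutHighDeg d ω (adjMat ω) - P) x‖ ≤ 4002 * √d * ‖x‖ := by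
  have e : zeroOutHighDeg d ω (adjMat ω) - P =
      trimmedCentered d P ω + (zeroOutHighDeg d ω P - P) := by
    ext i j
    simp only [trimmedCentered, zeroOutHighDeg, Matrix.sub_apply, Matrix.add_apply]
    split_ifs <;> ring
  have h1 := norm_toEuclideanLin_le_of_int hN (B := trimmedCentered d P ω)
    (zeroOutHighDeg_comm d ω fun i j => by
      rw [Matrix.sub_apply, Matrix.sub_apply, adjMat_comm, hPs])
    (K := 32000 * √d) (by positivity)
    (fun κ hκ => (h.abs_trimmedCentered_le hN hd hP0 hPs hPn hP κ hκ).trans_eq (by ring)) x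
  have hT := h.card_high_degree_le hN hd (fun e => hPn e.1.1 e.1.2) fun e => hP e.1.1 e.1.2
  have h2 := norm_toEuclideanLin_le_sqrt (zeroOutHighDeg d ω P - P) x
  have h3 : √(∑ i, ∑ j, (zeroOutHighDeg d ω P - P) i j ^ 2) ≤ 2 * √d := by
    rw [Real.sqrt_le_left (by positivity), mul_pow, Real.sq_sqrt hd.le]
    linarith [sum_sq_zeroOutHighDeg_sub_le hN hd hPn hP hT]
  have h4 := mul_le_mul_of_nonneg_right h3 (norm_nonneg x)
  rw [e, map_add, LinearMap.add_apply]
  refine (norm_add_le _ _).trans ?_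
  linarith

end SpectralNorm

section BlockModel

/-- Matrix constant on the blocks of the two-block stochastic block model. -/
noncomputable def blockMat (n : ℕ) (a b : ℝ) : Matrix (Fin (2 * n)) (Fin (2 * n)) ℝ :=
  fun i j => if ((i : ℕ) < n ↔ (j : ℕ) < n) then a / n else b / n

/-- Indicator vector of the first block. -/
noncomputable def firstInd (n : ℕ) : EuclideanSpace ℝ (Fin (2 * n)) :=
  WithLp.toLp 2 fun i => if (i : ℕ) < n then 1 else 0

/-- Indicator vector of the second block. -/
noncomputable def secondInd (n : ℕ) : EuclideanSpace ℝ (Fin (2 * n)) :=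
  WithLp.toLp 2 fun i => if (i : ℕ) < n then 0 else 1

lemma inner_firstInd_firstInd (n : ℕ) : inner ℝ (firstInd n) (firstInd n) = (n : ℝ) := by
  rw [PiLp.inner_apply]
  simp [firstInd, Fin.card_filter_val_lt, two_mul]

lemma inner_secondInd_secondInd (n : ℕ) : inner ℝ (secondInd n) (secondInd n) = (n : ℝ) := by
  have h1 : inner ℝ (firstInd n) (firstInd n) + inner ℝ (secondInd n) (secondInd n) =
      (2 * n : ℝ) := by
    rw [PiLp.inner_apply, PiLp.inner_apply, ← Finset.sum_add_distrib]
    have : ∀ i : Fin (2 * n), inner ℝ (firstInd n i) (firstInd n i) +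
        inner ℝ (secondInd n i) (secondInd n i) = (1 : ℝ) := fun i => by
      simp only [firstInd, secondInd]
      split_ifs <;> simp
    rw [Finset.sum_congr rfl fun i _ => this i]
    simp
  rw [inner_firstInd_firstInd] at h1
  linarith

lemma inner_firstInd_secondInd (n : ℕ) : inner ℝ (firstInd n) (secondInd n) = (0 : ℝ) := by
  rw [PiLp.inner_apply]
  refine Finset.sum_eq_zero fun i _ => ?_
  simp only [firstInd, secondInd]
  split_ifs <;> simp

lemma toEuclideanLin_blockMat (n : ℕ) (a b : ℝ) (x : EuclideanSpace ℝ (Fin (2 * n))) :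
    Matrix.toEuclideanLin (blockMat n a b) x =
      (a / n * inner ℝ (firstInd n) x + b / n * inner ℝ (secondInd n) x) • firstInd n +
      (b / n * inner ℝ (firstInd n) x + a / n * inner ℝ (secondInd n) x) • secondInd n := by
  ext i
  simp only [Matrix.toLpLin_apply, Matrix.mulVec, dotProduct, PiLp.add_apply, PiLp.smul_apply,
    smul_eq_mul, PiLp.inner_apply, RCLike.inner_apply, conj_trivial, Finset.mul_sum,
    ← Finset.sum_add_distrib, Finset.sum_mul]
  refine Finset.sum_congr rfl fun j _ => ?_
  simp only [blockMat, firstInd, secondInd]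
  by_cases hi : (i : ℕ) < n <;> by_cases hj : (j : ℕ) < n <;> simp [hi, hj]

/-- The space of vectors constant on both blocks. -/
noncomputable def blockSpace (n : ℕ) : Submodule ℝ (EuclideanSpace ℝ (Fin (2 * n))) :=
  Submodule.span ℝ {firstInd n, secondInd n}

lemma finrank_blockSpace {n : ℕ} (hn : 0 < n) : Module.finrank ℝ (blockSpace n) = 2 := by
  have hn' : (n : ℝ) ≠ 0 := by positivity
  have hli : LinearIndependent ℝ ![firstInd n, secondInd n] := by
    rw [LinearIndependent.pair_iff]
    intro s t hst
    have h1 := congrArg (inner ℝ (firstInd n)) hst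
    have h2 := congrArg (inner ℝ (secondInd n)) hst
    simp only [inner_add_right, real_inner_smul_right, inner_zero_right, inner_firstInd_firstInd,
      inner_secondInd_secondInd, inner_firstInd_secondInd,
      real_inner_comm (firstInd n) (secondInd n), mul_zero, add_zero, zero_add, mul_eq_zero, hn',
      or_false] at h1 h2
    exact ⟨h1, h2⟩
  rw [blockSpace, ← Matrix.range_cons_cons_empty _ _ ![], finrank_span_eq_card hli,
    Fintype.card_fin]

lemma toEuclideanLin_blockMat_mem (n : ℕ) (a b : ℝ) (x : EuclideanSpace ℝ (Fin (2 * n))) :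
    Matrix.toEuclideanLin (blockMat n a b) x ∈ blockSpace n := by
  rw [toEuclideanLin_blockMat]
  exact Submodule.mem_span_pair.2 ⟨_, _, rfl⟩

lemma le_inner_toEuclideanLin_blockMat {n : ℕ} (hn : 0 < n) {a b : ℝ} (hb : 0 ≤ b)
    {x : EuclideanSpace ℝ (Fin (2 * n))} (hx : x ∈ blockSpace n) :
    (a - b) * ‖x‖ ^ 2 ≤ inner ℝ (Matrix.toEuclideanLin (blockMat n a b) x) x := by
  have hn' : (n : ℝ) ≠ 0 := by positivity
  obtain ⟨s, t, rfl⟩ := Submodule.mem_span_pair.1 hx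
  rw [toEuclideanLin_blockMat, ← real_inner_self_eq_norm_sq]
  simp only [inner_add_right, inner_add_left, real_inner_smul_right, real_inner_smul_left,
    inner_firstInd_firstInd, inner_secondInd_secondInd, inner_firstInd_secondInd,
    real_inner_comm (firstInd n) (secondInd n)]
  have h1 : 0 ≤ n * (b * (s + t) ^ 2) := by positivity
  have h2 : a / n * (s * n) = a * s := by field_simp
  have h3 : a / n * (t * n) = a * t := by field_simp
  have h4 : b / n * (s * n) = b * s := by field_simp
  have h5 : b / n * (t * n) = b * t := by field_simp
  simp only [mul_zero, add_zero, zero_add, h2, h3, h4, h5]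
  nlinarith

lemma toEuclideanLin_expAdj (n : ℕ) (a b : ℝ) (x : EuclideanSpace ℝ (Fin (2 * n))) :
    Matrix.toEuclideanLin (expAdj n a b) x =
      Matrix.toEuclideanLin (blockMat n a b) x - (a / n) • x := by
  have h : expAdj n a b = blockMat n a b - (a / n) • (1 : Matrix _ _ ℝ) := by
    ext i j
    simp only [expAdj, blockMat, Matrix.sub_apply, Matrix.smul_apply, Matrix.one_apply, smul_eq_mul]
    by_cases hij : i = j
    · simp [hij]
    · simp [hij]
  rw [h, map_sub, map_smul]
  simp

lemma expAdj_comm (n : ℕ) (a b : ℝ) (i j : Fin (2 * n)) : expAdj n a b i j = expAdj n a b j i := by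
  simp only [expAdj, eq_comm (a := i), iff_comm (a := (i : ℕ) < n)]

/-- Top two eigenspaces of matrices close to the mean adjacency matrix are close to the space of
vectors constant on both blocks. -/
lemma IsTopTwoSpace.norm_starProjection_sub_le {n : ℕ} (hn : 0 < n) {a b c η : ℝ}
    (hb : 0 ≤ b) (hab : b < a) (hη : 0 ≤ η) (hc : c ≤ 1) (hηc : 12 * (η + a / n) ≤ c * (a - b))
    {M : Matrix (Fin (2 * n)) (Fin (2 * n)) ℝ} (hM : ∀ i j, M i j = M j i)
    (hclose : ∀ x, ‖Matrix.toEuclideanLin (M - expAdj n a b) x‖ ≤ η * ‖x‖)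
    {W : Submodule ℝ (EuclideanSpace ℝ (Fin (2 * n)))} (hW : IsTopTwoSpace M W) :
    ‖(blockSpace n).starProjection - W.starProjection‖ ≤ c := by
  obtain ⟨u₁, u₂, μ₁, μ₂, h12, h1, h2, rfl, e1, e2, h⟩ := hW
  have han : 0 ≤ a / n := div_nonneg (by linarith) (Nat.cast_nonneg n)
  refine norm_starProjection_sub_le_of_top_two (isSymmetric_toEuclideanLin hM)
    (finrank_blockSpace hn) (toEuclideanLin_blockMat_mem n a b)
    (fun x hx => le_inner_toEuclideanLin_blockMat hn hb hx) (fun x => ?_) (sub_pos.2 hab)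
    (add_nonneg hη han) hc hηc h12 h1 h2 e1 e2 h
  have h3 : Matrix.toEuclideanLin M x - Matrix.toEuclideanLin (blockMat n a b) x =
      Matrix.toEuclideanLin (M - expAdj n a b) x - (a / n) • x := by
    rw [map_sub, LinearMap.sub_apply, toEuclideanLin_expAdj]; abel
  rw [h3, add_mul]
  refine (norm_sub_le _ _).trans (add_le_add (hclose x) ?_)
  rw [norm_smul, Real.norm_of_nonneg han]

lemma sinAngle_eq {N : ℕ} (W₁ W₂ : Submodule ℝ (EuclideanSpace ℝ (Fin N))) :
    sinAngle W₁ W₂ = ‖W₁.starProjection - W₂.starProjection‖ := rfl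

lemma sinAngle_le_of_isTypical {n : ℕ} (hn : 0 < n) {a b c : ℝ} (hb : 0 < b) (hab : b < a)
    (hc0 : 0 < c) (hc : c ≤ 1) (hsep : 96072 / c * √(a + b) ≤ a - b) (han : a / n ≤ √(a + b))
    {ω : Config (2 * n)}
    (h : IsTypical (fun e => expAdj n a b e.1.1 e.1.2) (a + b) ω)
    {Wb W : Submodule ℝ (EuclideanSpace ℝ (Fin (2 * n)))} (hWb : IsTopTwoSpace (expAdj n a b) Wb)
    (hW : IsTopTwoSpace (zeroOutHighDeg (a + b) ω (adjMat ω)) W) : sinAngle Wb W ≤ c := by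
  have hn' : (0 : ℝ) < n := by exact_mod_cast hn
  have hs : 0 ≤ √(a + b) := Real.sqrt_nonneg _
  have hgap : 48036 * √(a + b) ≤ c / 2 * (a - b) := by
    calc 48036 * √(a + b) = c / 2 * (96072 / c * √(a + b)) := by field_simp; ring
      _ ≤ _ := by gcongr
  have hentry : ∀ i j, 0 ≤ expAdj n a b i j ∧ expAdj n a b i j ≤ 2 * (a + b) / (2 * n : ℕ) := by
    intro i j
    have e : 2 * (a + b) / (2 * n : ℕ) = (a + b) / n := by push_cast; field_simp
    have h1 : 0 ≤ a / n := div_nonneg (by linarith) hn'.le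
    have h2 : 0 ≤ b / n := div_nonneg hb.le hn'.le
    rw [e, add_div, expAdj]
    split_ifs <;> constructor <;> linarith
  have h1 := IsTopTwoSpace.norm_starProjection_sub_le hn hb.le hab (η := 4002 * √(a + b))
    (c := c / 2) (by positivity) (by linarith) (by linarith)
    (zeroOutHighDeg_comm _ ω (adjMat_comm ω))
    (h.norm_sub_le (by omega) (by linarith) (fun i => by simp [expAdj]) (expAdj_comm n a b)
      (fun i j => (hentry i j).1) fun i j => (hentry i j).2) hW
  have h2 := IsTopTwoSpace.norm_starProjection_sub_le hn hb.le hab (η := 0) (c := c / 2) le_rfl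
    (by linarith) (by linarith) (expAdj_comm n a b) (by simp) hWb
  rw [sinAngle_eq]
  calc _ = ‖((blockSpace n).starProjection - W.starProjection) -
        ((blockSpace n).starProjection - Wb.starProjection)‖ := by congr 1; abel
    _ ≤ c / 2 + c / 2 := (norm_sub_le _ _).trans (add_le_add h1 h2)
    _ = c := by ring

lemma sbm2_eq (n : ℕ) (a b : ℝ) :
    sbm2 n a b = Measure.pi fun e => bern (expAdj n a b e.1.1 e.1.2) := by
  unfold sbm2
  congr 1
  funext e
  rw [expAdj, if_neg e.2.ne]

lemma tendsto_failure_bound : Tendsto (fun n : ℕ => 3 * Real.exp (-(2 * n : ℕ)) +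
    Nat.log 4 (64 * (2 * n)) * Real.exp (-(Nat.log 4 (64 * (2 * n)) : ℕ))) atTop (nhds 0) := by
  have h1 : Tendsto (fun n : ℕ => ((2 * n : ℕ) : ℝ)) atTop atTop :=
    tendsto_natCast_atTop_atTop.comp (tendsto_id.const_mul_atTop' two_pos)
  have h2 : Tendsto (fun n : ℕ => ((Nat.log 4 (64 * (2 * n)) : ℕ) : ℝ)) atTop atTop := by
    refine tendsto_natCast_atTop_atTop.comp (tendsto_atTop.2 fun m => ?_)
    filter_upwards [eventually_ge_atTop (4 ^ m)] with n hn
    exact Nat.le_log_of_pow_le (by norm_num) (by omega)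
  have h3 := ((Real.tendsto_exp_neg_atTop_nhds_zero.comp h1).const_mul 3).add
    ((Real.tendsto_pow_mul_exp_neg_atTop_nhds_zero 1).comp h2)
  simpa using h3

end BlockModel

/-- Lemma 3.5 / `lem:VW_angle`: for any constant `0 < c < 1` there
are constants `C₂, C₃` such that if `a - b ≥ C₂ √(a+b)` and `a ≥ C₃`, then with
probability `1 - o(1)` the top-two eigenspaces `W̄` of `Ā₀` and `W` of the pruned
adjacency matrix `A` satisfy `sin ∠(W̄, W) ≤ c`. -/
theorem sbm_top_two_eigenspace_angle_bound :
    ∀ c : ℝ, 0 < c → c < 1 →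
      ∃ C₂ C₃ : ℝ, ∀ a b : ℝ, 0 < b → b < a →
        C₂ * Real.sqrt (a + b) ≤ a - b → C₃ ≤ a →
        Tendsto
          (fun n => sbm2 n a b
            {ω | ∀ Wb W, IsTopTwoSpace (expAdj n a b) Wb →
              IsTopTwoSpace (zeroOutHighDeg (a + b) ω (adjMat ω)) W →
              sinAngle Wb W ≤ c})
          atTop (nhds 1) := by
  intro c hc0 hc1
  refine ⟨96072 / c, 0, fun a b hb hab hsep _ => ?_⟩
  set G : (n : ℕ) → Set (Config (2 * n)) := fun n =>
    {ω | ∀ Wb W, IsTopTwoSpace (expAdj n a b) Wb →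
      IsTopTwoSpace (zeroOutHighDeg (a + b) ω (adjMat ω)) W → sinAngle Wb W ≤ c} with hG
  have hprob : ∀ n, IsProbabilityMeasure (sbm2 n a b) := fun n => by
    unfold sbm2; infer_instance
  have hreal : Tendsto (fun n => (sbm2 n a b).real (G n)) atTop (nhds 1) := by
    have hlow := tendsto_failure_bound.const_sub 1
    rw [sub_zero] at hlow
    refine tendsto_of_tendsto_of_tendsto_of_le_of_le' hlow tendsto_const_nhds ?_
      (Eventually.of_forall fun n => measureReal_le_one)
    have hlim := tendsto_const_div_atTop_nhds_zero_nat a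
    filter_upwards [hlim.eventually_le_const (Real.sqrt_pos.2 (by linarith : 0 < a + b)),
      hlim.eventually_le_const one_pos, eventually_gt_atTop 0] with n hn1 hn2 hn0
    have hn' : (0 : ℝ) < n := by exact_mod_cast hn0
    have hp : ∀ e : EdgeIdx (2 * n), 0 ≤ expAdj n a b e.1.1 e.1.2 ∧
        expAdj n a b e.1.1 e.1.2 ≤ 1 := fun e => by
      have h1 : 0 ≤ b / n := div_nonneg hb.le hn'.le
      have h2 : b / n ≤ a / n := by gcongr
      rw [expAdj]
      split_ifs <;> constructor <;> linarith
    have hbad := measureReal_not_isTypical_le (fun e => (hp e).1) (fun e => (hp e).2) (a + b)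
    rw [← sbm2_eq] at hbad
    have hsub : {ω | ¬ IsTypical (fun e => expAdj n a b e.1.1 e.1.2) (a + b) ω}ᶜ ⊆ G n :=
      fun ω hω Wb W hWb hW =>
        sinAngle_le_of_isTypical hn0 hb hab hc0 hc1.le hsep hn1 (not_not.1 hω) hWb hW
    have hmono := measureReal_mono (μ := sbm2 n a b) hsub
    rw [probReal_compl_eq_one_sub (Set.toFinite _).measurableSet] at hmono
    linarith
  have h := ENNReal.tendsto_ofReal hreal
  rw [ENNReal.ofReal_one] at h
  exact h.congr fun n => ofReal_measureReal
end

section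
/- Let W̄ and W be two 2-dimensional subspaces of ℝ^N with sin∠(W̄, W) ≤ c ≤ 1/4, and let v̄₁, v̄₂ be an orthonormal basis of W̄. Let u₁ be the orthogonal projection of v̄₁ onto W, and let v be a unit vector in W perpendicular to u₁. Then |vᵀ v̄₂| ≥ 1 − 2c, and consequently sin∠(v, v̄₂) ≤ 2√c. -/
open MeasureTheory Filter Finset

/-- Two orthonormal vectors in a two-dimensional subspace span it. -/
lemma span_pair_eq_of_orthonormal {E : Type*} [NormedAddCommGroup E] [InnerProductSpace ℝ E]
    {K : Submodule ℝ E} (hK : Module.finrank ℝ K = 2) {x y : E} (hxK : x ∈ K) (hyK : y ∈ K)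
    (hx : ‖x‖ = 1) (hy : ‖y‖ = 1) (hxy : (inner ℝ x y : ℝ) = 0) :
    Submodule.span ℝ {x, y} = K := by
  have : FiniteDimensional ℝ K := Module.finite_of_finrank_eq_succ hK
  have hon : Orthonormal ℝ ![x, y] := by simp [hx, hy, hxy]
  apply Submodule.eq_of_le_of_finrank_eq
  · rw [Submodule.span_le]
    rintro z (rfl | rfl) <;> assumption
  · have h := finrank_span_eq_card hon.linearIndependent
    rw [Matrix.range_cons, Matrix.range_cons, Matrix.range_empty, Set.union_empty,
      Set.singleton_union, Fintype.card_fin] at h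
    rw [h, hK]

/-- The projection onto a two-dimensional subspace of a vector orthogonal to the first vector
of an orthonormal basis is its component along the second. -/
lemma projCLM_eq_inner_smul_of_inner_eq_zero {N : ℕ}
    {K : Submodule ℝ (EuclideanSpace ℝ (Fin N))} (hK : Module.finrank ℝ K = 2)
    {x y : EuclideanSpace ℝ (Fin N)} (hxK : x ∈ K) (hyK : y ∈ K)
    (hx : ‖x‖ = 1) (hy : ‖y‖ = 1) (hxy : (inner ℝ x y : ℝ) = 0)
    {v : EuclideanSpace ℝ (Fin N)} (hxv : (inner ℝ x v : ℝ) = 0) :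
    projCLM K v = (inner ℝ v y : ℝ) • y := by
  change K.starProjection v = _
  apply Submodule.eq_starProjection_of_mem_of_inner_eq_zero (K.smul_mem _ hyK)
  intro w hw
  rw [← span_pair_eq_of_orthonormal hK hxK hyK hx hy hxy, Submodule.mem_span_pair] at hw
  obtain ⟨a, b, rfl⟩ := hw
  have hvx : (inner ℝ v x : ℝ) = 0 := by rw [real_inner_comm, hxv]
  have hyx : (inner ℝ y x : ℝ) = 0 := by rw [real_inner_comm, hxy]
  simp [inner_sub_left, inner_add_right, real_inner_smul_left, real_inner_smul_right, hvx, hyx, hy]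

/-- Lemma A.2 / `lem:vu_angle`: if `W̄, W` are 2-dimensional
subspaces with `sin ∠(W̄, W) ≤ c ≤ 1/4`, `v̄₁, v̄₂` is an orthonormal basis of `W̄`,
`u₁` is the orthogonal projection of `v̄₁` onto `W` and `v ∈ W` is a unit vector with
`v ⊥ u₁`, then `|vᵀ v̄₂| ≥ 1 - 2c` and hence `sin ∠(v, v̄₂) ≤ 2√c`. -/
theorem projection_of_orthonormal_basis_angle_bound
    (N : ℕ) (c : ℝ) (hc : c ≤ 1 / 4)
    (Wb W : Submodule ℝ (EuclideanSpace ℝ (Fin N)))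
    (hWb : Module.finrank ℝ Wb = 2) (hW : Module.finrank ℝ W = 2)
    (hangle : sinAngle Wb W ≤ c)
    (v1 v2 : EuclideanSpace ℝ (Fin N))
    (hv1 : v1 ∈ Wb) (hv2 : v2 ∈ Wb) (h1 : ‖v1‖ = 1) (h2 : ‖v2‖ = 1)
    (horth : (inner ℝ v1 v2 : ℝ) = 0)
    (v : EuclideanSpace ℝ (Fin N)) (hvW : v ∈ W) (hv : ‖v‖ = 1)
    (hperp : (inner ℝ (projCLM W v1) v : ℝ) = 0) :
    1 - 2 * c ≤ |(inner ℝ v v2 : ℝ)| ∧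
    Real.sqrt (1 - (inner ℝ v v2 : ℝ) ^ 2) ≤ 2 * Real.sqrt c := by
  have hPv : projCLM W v = v := Submodule.starProjection_eq_self_iff.mpr hvW
  have hv1v : (inner ℝ v1 v : ℝ) = 0 := by
    rw [← hPv, ← hperp]
    exact (Submodule.inner_starProjection_left_eq_right W v1 v).symm
  have hPb := projCLM_eq_inner_smul_of_inner_eq_zero hWb hv1 hv2 h1 h2 horth hv1v
  set a : ℝ := inner ℝ v v2 with ha
  have hdist : ‖a • v2 - v‖ ≤ c := by
    have h := (projCLM Wb - projCLM W).le_opNorm v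
    rw [sub_apply, hPb, hPv, hv, mul_one] at h
    exact h.trans hangle
  have hc0 : 0 ≤ c := (norm_nonneg _).trans hdist
  have hsq : 1 - a ^ 2 ≤ c ^ 2 := by
    have h : ‖a • v2 - v‖ ^ 2 = 1 - a ^ 2 := by
      rw [norm_sub_sq_real, real_inner_smul_left, real_inner_comm, ← ha, norm_smul, h2, hv,
        Real.norm_eq_abs, mul_one, sq_abs]
      ring
    rw [← h]
    gcongr
  constructor
  · nlinarith [sq_abs a, abs_nonneg a]
  · calc Real.sqrt (1 - a ^ 2) ≤ Real.sqrt (2 ^ 2 * c) := Real.sqrt_le_sqrt (by nlinarith)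
      _ = 2 * Real.sqrt c := by rw [Real.sqrt_mul (by norm_num), Real.sqrt_sq (by norm_num)]
end

section
/- Let V = V₁ ∪ V₂ with |V₁| = |V₂| = n, let W̄ ⊂ ℝ^{2n} be the span of the all-ones direction v̄₁ (all coordinates 1/√(2n)) and the block-indicator direction v̄₂ (coordinates 1/√(2n) on V₁ and −1/√(2n) on V₂). Given any 2-dimensional subspace W with sin∠(W̄, W) ≤ c < 1/16, the following procedure recovers an (8c/3)-correct partition: project the all-ones vector onto W, take a unit vector v in W perpendicular to this projection, and take the sign partition of v (sorting vertices by their value in v and splitting into the top n and bottom n). -/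
open MeasureTheory Filter Finset

/-- Averaging bound: if `w` takes the value `m` on `A` and `-m` on a disjoint set `B` of the same
size while `v` is at most as large on `A` as on `B`, then `v` is far from `w` in `ℓ²`. -/
theorem two_mul_card_mul_sq_le_sum_sub_sq {ι : Type*} [Fintype ι] [DecidableEq ι]
    (A B : Finset ι) (hAB : Disjoint A B) (hcard : A.card = B.card) (v w : ι → ℝ) (m : ℝ)
    (hm : 0 ≤ m) (hA : ∀ i ∈ A, w i = m) (hB : ∀ i ∈ B, w i = -m)
    (hv : ∀ j ∈ A, ∀ i ∈ B, v j ≤ v i) :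
    2 * (A.card : ℝ) * m ^ 2 ≤ ∑ i, (w i - v i) ^ 2 := by
  have hsum : ∑ j ∈ A, v j ≤ ∑ i ∈ B, v i := by
    rw [← Finset.sum_coe_sort A, ← Finset.sum_coe_sort B,
      ← (Finset.equivOfCardEq hcard).sum_comp]
    exact Finset.sum_le_sum fun j _ => hv j j.2 _ (Finset.equivOfCardEq hcard j).2
  have h1 : ∑ j ∈ A, (m ^ 2 - 2 * m * v j) ≤ ∑ j ∈ A, (w j - v j) ^ 2 :=
    Finset.sum_le_sum fun j hj => by rw [hA j hj]; nlinarith [sq_nonneg (v j)]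
  have h2 : ∑ i ∈ B, (m ^ 2 + 2 * m * v i) ≤ ∑ i ∈ B, (w i - v i) ^ 2 :=
    Finset.sum_le_sum fun i hi => by rw [hB i hi]; nlinarith [sq_nonneg (v i)]
  have h3 : ∑ i ∈ A ∪ B, (w i - v i) ^ 2 ≤ ∑ i, (w i - v i) ^ 2 :=
    Finset.sum_le_sum_of_subset_of_nonneg (Finset.subset_univ _) fun i _ _ => sq_nonneg _
  rw [Finset.sum_union hAB] at h3
  rw [Finset.sum_sub_distrib, ← Finset.mul_sum, Finset.sum_const, nsmul_eq_mul] at h1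
  rw [Finset.sum_add_distrib, ← Finset.mul_sum, Finset.sum_const, nsmul_eq_mul, ← hcard] at h2
  nlinarith [mul_le_mul_of_nonneg_left hsum hm]

theorem block2_eq_compl (n : ℕ) : block2 n = (block1 n)ᶜ := by
  ext i; simp [block1, block2]

theorem card_block1 (n : ℕ) : (block1 n).card = n := by
  rw [block1, Fin.card_filter_val_lt]; omega

theorem sum_block_sign (n : ℕ) (x : ℝ) :
    ∑ i : Fin (2 * n), (if (i : ℕ) < n then x else -x) = 0 := by
  have h2 : (block2 n).card = n := by
    rw [block2_eq_compl, Finset.card_compl, card_block1, Fintype.card_fin]; omega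
  have h1 := card_block1 n
  rw [block1] at h1
  rw [block2] at h2
  rw [Finset.sum_ite, Finset.sum_const, Finset.sum_const, h1, h2]
  simp

theorem inner_vbar1_vbar2 (n : ℕ) : (inner ℝ (vbar1 n) (vbar2 n) : ℝ) = 0 := by
  simp only [vbar1, vbar2, mkVec, PiLp.inner_apply, RCLike.inner_apply]
  simp only [EuclideanSpace.equiv, PiLp.coe_symm_continuousLinearEquiv, conj_trivial]
  rw [← Finset.sum_mul, sum_block_sign, zero_mul]

theorem norm_sq_vbar1 {n : ℕ} (hn : 0 < n) : ‖vbar1 n‖ ^ 2 = 1 := by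
  have : (0 : ℝ) < n := by exact_mod_cast hn
  rw [EuclideanSpace.norm_sq_eq]
  simp [vbar1, mkVec, EuclideanSpace.equiv]
  field_simp
  rw [sq_abs, sq_abs, Real.sq_sqrt this.le, Real.sq_sqrt zero_le_two, mul_comm]

theorem norm_sq_vbar2 {n : ℕ} (hn : 0 < n) : ‖vbar2 n‖ ^ 2 = 1 := by
  have h : (0 : ℝ) < n := by exact_mod_cast hn
  rw [← norm_sq_vbar1 hn, EuclideanSpace.norm_sq_eq, EuclideanSpace.norm_sq_eq]
  refine Finset.sum_congr rfl fun i _ => ?_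
  simp only [vbar1, vbar2, mkVec, EuclideanSpace.equiv, PiLp.coe_symm_continuousLinearEquiv]
  split_ifs <;> simp

/-- A unit vector of `W` orthogonal to the projection of the all-ones vector is within
`sinAngle` of a multiple of `vbar2`. -/
theorem exists_norm_smul_vbar2_sub_le {n : ℕ} (hn : 0 < n) {c : ℝ}
    {W : Submodule ℝ (EuclideanSpace ℝ (Fin (2 * n)))}
    (hangle : sinAngle (Submodule.span ℝ {vbar1 n, vbar2 n}) W ≤ c)
    {v : EuclideanSpace ℝ (Fin (2 * n))} (hvW : v ∈ W) (hv : ‖v‖ = 1)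
    (hperp : (inner ℝ (projCLM W (mkVec fun _ => 1)) v : ℝ) = 0) :
    ∃ b : ℝ, ‖b • vbar2 n - v‖ ≤ c := by
  have hPW : projCLM W v = v := Submodule.starProjection_eq_self_iff.2 hvW
  have h1 : (inner ℝ (vbar1 n) v : ℝ) = 0 := by
    have h : vbar1 n = (1 / Real.sqrt (2 * n)) • mkVec fun _ => (1 : ℝ) := by
      ext i; simp [vbar1, mkVec, EuclideanSpace.equiv]
    have h' : (inner ℝ (W.starProjection (mkVec fun _ => 1)) v : ℝ) = 0 := hperp
    rw [Submodule.inner_starProjection_left_eq_right,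
      Submodule.starProjection_eq_self_iff.2 hvW] at h'
    rw [h, inner_smul_left, h', mul_zero]
  set U := Submodule.span ℝ {vbar1 n, vbar2 n} with hU
  have hmem : projCLM U v ∈ U := U.starProjection_apply_mem v
  obtain ⟨a, b, hab⟩ := Submodule.mem_span_pair.1 hmem
  have h2 : (inner ℝ (v - projCLM U v) (vbar1 n) : ℝ) = 0 :=
    U.starProjection_inner_eq_zero v _ (Submodule.subset_span (by simp))
  have ha : a = 0 := by
    rw [← hab, inner_sub_left, inner_add_left, inner_smul_left, inner_smul_left,
      real_inner_comm, h1, real_inner_comm (vbar1 n) (vbar2 n), inner_vbar1_vbar2,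
      real_inner_self_eq_norm_sq, norm_sq_vbar1 hn] at h2
    simpa using h2
  refine ⟨b, ?_⟩
  have h3 := (projCLM U - projCLM W).le_opNorm v
  rw [sub_apply, hPW, ← hab, ha, zero_smul, zero_add, hv, mul_one] at h3
  exact h3.trans hangle

/-- A set of misclassified vertices is small when its size is controlled by the distance
from `v` to a multiple `b • vbar2`. -/
theorem card_le_of_norm_smul_vbar2_sub_le {n : ℕ} (hn : 0 < n) {b c : ℝ} (hc : c < 1 / 16)
    {v : EuclideanSpace ℝ (Fin (2 * n))} (hv : ‖v‖ = 1) (hb : ‖b • vbar2 n - v‖ ≤ c)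
    (A B : Finset (Fin (2 * n))) (hAB : Disjoint A B) (hcard : A.card = B.card)
    (hA : ∀ i ∈ A, (b • vbar2 n) i = |b| / Real.sqrt (2 * n))
    (hB : ∀ i ∈ B, (b • vbar2 n) i = -(|b| / Real.sqrt (2 * n)))
    (hsort : ∀ j ∈ A, ∀ i ∈ B, v j ≤ v i) :
    (A.card : ℝ) ≤ 8 * c / 3 * n := by
  have h_n : (0 : ℝ) < n := by exact_mod_cast hn
  have hc0 : 0 ≤ c := (norm_nonneg _).trans hb
  have h := two_mul_card_mul_sq_le_sum_sub_sq A B hAB hcard v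
    (fun i => (b • vbar2 n) i) _
    (by positivity) hA hB hsort
  have hnorm : ‖b • vbar2 n - v‖ ^ 2 = ∑ i, ((b • vbar2 n) i - v i) ^ 2 := by
    rw [EuclideanSpace.norm_sq_eq]
    simp
  rw [← hnorm, div_pow, sq_abs, Real.sq_sqrt (by positivity)] at h
  have hb1 : 1 - c ≤ |b| := by
    have h2 : ‖vbar2 n‖ = 1 :=
      (pow_eq_one_iff_of_nonneg (norm_nonneg _) two_ne_zero).1 (norm_sq_vbar2 hn)
    have h3 := norm_sub_norm_le v (b • vbar2 n)
    rw [hv, norm_smul, h2, mul_one, Real.norm_eq_abs, norm_sub_rev] at h3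
    linarith
  have hb2 : 15 / 16 * (15 / 16) ≤ b ^ 2 := by
    rw [← sq_abs]; nlinarith
  have h4 : ‖b • vbar2 n - v‖ ^ 2 ≤ c * (1 / 16) := by
    nlinarith [norm_nonneg (b • vbar2 n - v)]
  have h5 : (A.card : ℝ) * b ^ 2 ≤ c * (1 / 16) * n := by
    rw [← div_le_iff₀ h_n]
    refine le_trans (le_of_eq ?_) (h.trans h4)
    field_simp
  have h6 : (A.card : ℝ) * (15 / 16 * (15 / 16)) ≤ A.card * b ^ 2 :=
    mul_le_mul_of_nonneg_left hb2 (Nat.cast_nonneg _)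
  nlinarith [mul_nonneg hc0 h_n.le]

/-- Lemma 3.6: if `W` is a 2-dimensional subspace with
`sin ∠(W̄, W) ≤ c < 1/16`, where `W̄ = span{v̄₁, v̄₂}`, then taking a unit vector
`v ∈ W` orthogonal to the projection of the all-ones vector onto `W` and splitting the
vertices into the top `n` and bottom `n` by their value in `v` yields an
`(8c/3)`-correct partition (after choosing the labelling of the two parts
appropriately). -/
theorem recovery_from_top_two_eigenspace
    (n : ℕ) (c : ℝ) (hc : c < 1 / 16)
    (W : Submodule ℝ (EuclideanSpace ℝ (Fin (2 * n))))
    (hWdim : Module.finrank ℝ W = 2)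
    (hangle : sinAngle (Submodule.span ℝ {vbar1 n, vbar2 n}) W ≤ c)
    (v : EuclideanSpace ℝ (Fin (2 * n))) (hvW : v ∈ W) (hv : ‖v‖ = 1)
    (hperp : (inner ℝ (projCLM W (mkVec fun _ => 1)) v : ℝ) = 0)
    (P : Finset (Fin (2 * n)) × Finset (Fin (2 * n)))
    (hcard : P.1.card = n) (hcompl : P.2 = P.1ᶜ)
    (hsort : ∀ i ∈ P.1, ∀ j ∈ P.2, v j ≤ v i) :
    correct2 n (8 * c / 3) P ∨ correct2 n (8 * c / 3) P.swap := by
  rcases Nat.eq_zero_or_pos n with rfl | hn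
  · left; simp [correct2]
  obtain ⟨b, hb⟩ := exists_norm_smul_vbar2_sub_le hn hangle hvW hv hperp
  obtain ⟨P₁, P₂⟩ := P
  dsimp only at hcard hcompl hsort
  subst hcompl
  have e1 := Finset.card_inter_add_card_sdiff (block1 n) P₁
  have e2 := Finset.card_inter_add_card_sdiff (block2 n) P₁
  have e3 := Finset.card_inter_add_card_sdiff P₁ (block1 n)
  rw [Finset.sdiff_eq_inter_compl, card_block1] at e1
  rw [Finset.sdiff_eq_inter_compl, block2_eq_compl, Finset.card_compl, card_block1,
    Fintype.card_fin] at e2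
  rw [Finset.sdiff_eq_inter_compl, Finset.inter_comm, Finset.inter_comm P₁, hcard] at e3
  have hv2 : ∀ i, (b • vbar2 n) i =
      if (i : ℕ) < n then b / Real.sqrt (2 * n) else -(b / Real.sqrt (2 * n)) := by
    intro i
    simp only [vbar2, mkVec, EuclideanSpace.equiv, PiLp.coe_symm_continuousLinearEquiv,
      PiLp.smul_apply, smul_eq_mul]
    split_ifs <;> ring
  have hblock1 : ∀ i ∈ block1 n, (b • vbar2 n) i = b / Real.sqrt (2 * n) := fun i hi => by
    rw [hv2, if_pos (by simpa [block1] using hi)]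
  have hblock2 : ∀ i ∈ (block1 n)ᶜ, (b • vbar2 n) i = -(b / Real.sqrt (2 * n)) := fun i hi => by
    rw [hv2, if_neg (by simpa [block1] using hi)]
  have hdisj : Disjoint (block1 n) (block1 n)ᶜ := disjoint_compl_right
  simp only [correct2, Prod.swap, block2_eq_compl]
  rcases le_total 0 b with h0 | h0
  · left
    have h := card_le_of_norm_smul_vbar2_sub_le hn hc hv hb (block1 n ∩ P₁ᶜ) ((block1 n)ᶜ ∩ P₁)
      (hdisj.mono Finset.inter_subset_left Finset.inter_subset_left) (by omega)
      (fun i hi => by rw [abs_of_nonneg h0, hblock1 i (Finset.mem_inter.1 hi).1])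
      (fun i hi => by rw [abs_of_nonneg h0, hblock2 i (Finset.mem_inter.1 hi).1])
      (fun j hj i hi => hsort i (Finset.mem_inter.1 hi).2 j (Finset.mem_inter.1 hj).2)
    have k1 : ((block1 n ∩ P₁).card : ℝ) + (block1 n ∩ P₁ᶜ).card = n := by exact_mod_cast e1
    have k2 : (((block1 n)ᶜ ∩ P₁ᶜ).card : ℝ) + (block1 n ∩ P₁ᶜ).card = n := by
      norm_cast; omega
    constructor <;> linarith
  · right
    have h := card_le_of_norm_smul_vbar2_sub_le hn hc hv hb ((block1 n)ᶜ ∩ P₁ᶜ) (block1 n ∩ P₁)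
      (hdisj.symm.mono Finset.inter_subset_left Finset.inter_subset_left) (by omega)
      (fun i hi => by rw [abs_of_nonpos h0, hblock2 i (Finset.mem_inter.1 hi).1]; ring)
      (fun i hi => by rw [abs_of_nonpos h0, hblock1 i (Finset.mem_inter.1 hi).1]; ring)
      (fun j hj i hi => hsort i (Finset.mem_inter.1 hi).2 j (Finset.mem_inter.1 hj).2)
    have k1 : ((block1 n ∩ P₁ᶜ).card : ℝ) + ((block1 n)ᶜ ∩ P₁ᶜ).card = n := by
      norm_cast; omega
    have k2 : (((block1 n)ᶜ ∩ P₁).card : ℝ) + ((block1 n)ᶜ ∩ P₁ᶜ).card = n := by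
      norm_cast; omega
    constructor <;> linarith
end
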